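/- arXiv:2011.09135 — 5 statements merged into one kernel-verified Lean document; each statement's English description precedes it below -/
import Mathlib

section
/- For every team t ∈ V, the slot-1 equation Σ_{j ∈ V∖{t}} (x_{1,t,j} + x_{1,j,t}) = 1 is implied by the other model equations: every x ∈ ℝ^M that satisfies Σ_{j ∈ V∖{t}} (x_{k,t,j} + x_{k,j,t}) = 1 for all k ∈ S∖{1}, and Σ_{k ∈ S} x_{k,i,j} = 1 for all (i,j) ∈ A with t ∈ {i,j}, also satisfies Σ_{j ∈ V∖{t}} (x_{1,t,j} + x_{1,j,t}) = 1. -/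
open Finset

attribute [local instance] Classical.propDecidable

namespace TTP

/-- `(k,i,j)` is a valid match index: slot `k ∈ S = {1,…,2n-2}`, home venue `i` and
away team `j` are distinct elements of `V = {1,…,n}`. -/
def IsMatch (n : ℕ) (m : ℕ × ℕ × ℕ) : Prop :=
  1 ≤ m.1 ∧ m.1 ≤ 2 * n - 2 ∧ 1 ≤ m.2.1 ∧ m.2.1 ≤ n ∧ 1 ≤ m.2.2 ∧ m.2.2 ≤ n ∧ m.2.1 ≠ m.2.2

/-- `(t,i,j)` is a valid travel index: `t ∈ V` and `(i,j) ∈ A`. -/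
def IsTravelIdx (n : ℕ) (p : ℕ × ℕ × ℕ) : Prop :=
  1 ≤ p.1 ∧ p.1 ≤ n ∧ 1 ≤ p.2.1 ∧ p.2.1 ≤ n ∧ 1 ≤ p.2.2 ∧ p.2.2 ≤ n ∧ p.2.1 ≠ p.2.2

/-- A (double round-robin) tournament: a set of matches such that in every slot every team
plays exactly once, and every ordered pair of distinct teams meets exactly once. -/
structure IsTournament (n : ℕ) (T : Set (ℕ × ℕ × ℕ)) : Prop where
  subset : ∀ m ∈ T, IsMatch n m
  slot_team : ∀ k, 1 ≤ k → k ≤ 2 * n - 2 → ∀ t, 1 ≤ t → t ≤ n →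
      ∃! m : ℕ × ℕ × ℕ, m ∈ T ∧ m.1 = k ∧ (t = m.2.1 ∨ t = m.2.2)
  pair : ∀ i j, 1 ≤ i → i ≤ n → 1 ≤ j → j ≤ n → i ≠ j → ∃! k : ℕ, (k, i, j) ∈ T

/-- The venue of team `t` in slot `k`: the home venue of the (unique) match of `t` in
slot `k`, and `t` itself if `t` has no match in slot `k` (in particular in the artificial
slots `0` and `2n-1`). -/
noncomputable def venue (T : Set (ℕ × ℕ × ℕ)) (t k : ℕ) : ℕ :=
  if h : ∃ i, ∃ j, (k, i, j) ∈ T ∧ (t = i ∨ t = j) then h.choose else t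

/-- The travel vector `ψ(T)`: `travel n T (t,i,j) = 1` iff for some `0 ≤ k ≤ 2n-2` team `t`
has venue `i` in slot `k` and venue `j` in slot `k+1`. -/
noncomputable def travel (n : ℕ) (T : Set (ℕ × ℕ × ℕ)) (p : ℕ × ℕ × ℕ) : ℝ :=
  if ∃ k, k ≤ 2 * n - 2 ∧ venue T p.1 k = p.2.1 ∧ venue T p.1 (k + 1) = p.2.2 then 1 else 0

/-- The play vector `χ(T)`: characteristic vector of `T`. -/
noncomputable def play (T : Set (ℕ × ℕ × ℕ)) (m : ℕ × ℕ × ℕ) : ℝ :=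
  if m ∈ T then 1 else 0

/-- The ambient space `ℝ^M × ℝ^{V×A}`. -/
abbrev Pt (n : ℕ) :=
  ({m : ℕ × ℕ × ℕ // IsMatch n m} → ℝ) × ({p : ℕ × ℕ × ℕ // IsTravelIdx n p} → ℝ)

/-- The play coordinate `x_{k,i,j}` of a point (0 at invalid indices). -/
noncomputable def xval {n : ℕ} (z : Pt n) (k i j : ℕ) : ℝ :=
  if h : IsMatch n (k, i, j) then z.1 ⟨(k, i, j), h⟩ else 0

/-- The travel coordinate `y_{t,i,j}` of a point (0 at invalid indices). -/
noncomputable def yval {n : ℕ} (z : Pt n) (t i j : ℕ) : ℝ :=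
  if h : IsTravelIdx n (t, i, j) then z.2 ⟨(t, i, j), h⟩ else 0

/-- The unconstrained traveling tournament polytope `Ptt(n)`:
the convex hull of all pairs `(χ(T), y)` with `T` a tournament and `y ∈ {0,1}^{V×A}`,
`y ≥ ψ(T)` componentwise. -/
def Ptt (n : ℕ) : Set (Pt n) :=
  convexHull ℝ { z : Pt n | ∃ T : Set (ℕ × ℕ × ℕ), IsTournament n T ∧
    (∀ m : {m : ℕ × ℕ × ℕ // IsMatch n m}, z.1 m = play T m.1) ∧
    (∀ p : {p : ℕ × ℕ × ℕ // IsTravelIdx n p}, z.2 p = 0 ∨ z.2 p = 1) ∧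
    (∀ p : {p : ℕ × ℕ × ℕ // IsTravelIdx n p}, travel n T p.1 ≤ z.2 p) }

/-- Dimension of the affine hull of a set. -/
noncomputable def adim {n : ℕ} (s : Set (Pt n)) : ℕ :=
  Module.finrank ℝ (affineSpan ℝ s).direction

/-- A valid inequality `f z ≤ γ` is facet-defining for `Ptt(n)`:
it holds on `Ptt(n)` and its face has dimension `dim Ptt(n) - 1`. -/
def IsFacetLE {n : ℕ} (f : Pt n → ℝ) (γ : ℝ) : Prop :=
  (∀ z ∈ Ptt n, f z ≤ γ) ∧ adim {z ∈ Ptt n | f z = γ} + 1 = adim (Ptt n)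

/-- A valid inequality `f z ≥ γ` is facet-defining for `Ptt(n)`:
it holds on `Ptt(n)` and its face has dimension `dim Ptt(n) - 1`. -/
def IsFacetGE {n : ℕ} (f : Pt n → ℝ) (γ : ℝ) : Prop :=
  (∀ z ∈ Ptt n, γ ≤ f z) ∧ adim {z ∈ Ptt n | f z = γ} + 1 = adim (Ptt n)


/-- The coordinate `x_{k,i,j}` of a play vector `x ∈ ℝ^M` (0 at invalid indices). -/
noncomputable def xcoord {n : ℕ} (x : {m : ℕ × ℕ × ℕ // IsMatch n m} → ℝ) (k i j : ℕ) : ℝ :=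
  if h : IsMatch n (k, i, j) then x ⟨(k, i, j), h⟩ else 0

/-- the slot-1 equation is implied by the remaining model equations. -/
theorem slot_one_equation_redundant (n : ℕ) (hn : 4 ≤ n) (heven : Even n)
    (t : ℕ) (ht1 : 1 ≤ t) (htn : t ≤ n)
    (x : {m : ℕ × ℕ × ℕ // IsMatch n m} → ℝ)
    (hslot : ∀ k, 1 ≤ k → k ≤ 2 * n - 2 → k ≠ 1 →
      ∑ j ∈ Finset.Icc 1 n \ {t}, (xcoord x k t j + xcoord x k j t) = 1)
    (hpair : ∀ i j, 1 ≤ i → i ≤ n → 1 ≤ j → j ≤ n → i ≠ j → (t = i ∨ t = j) →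
      ∑ k ∈ Finset.Icc 1 (2 * n - 2), xcoord x k i j = 1) :
    ∑ j ∈ Finset.Icc 1 n \ {t}, (xcoord x 1 t j + xcoord x 1 j t) = 1 := by
  have htotal : ∑ k ∈ Finset.Icc 1 (2 * n - 2), ∑ j ∈ Finset.Icc 1 n \ {t},
      (xcoord x k t j + xcoord x k j t) = 2 * (n - 1 : ℝ) := by
    rw [Finset.sum_comm]
    have hj : ∀ j ∈ Finset.Icc 1 n \ {t},
        ∑ k ∈ Finset.Icc 1 (2 * n - 2), (xcoord x k t j + xcoord x k j t) = (2 : ℝ) := by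
      intro j hj
      simp only [Finset.mem_sdiff, Finset.mem_Icc, Finset.mem_singleton] at hj
      rw [Finset.sum_add_distrib,
        hpair t j ht1 htn hj.1.1 hj.1.2 (Ne.symm hj.2) (Or.inl rfl),
        hpair j t hj.1.1 hj.1.2 ht1 htn hj.2 (Or.inr rfl)]
      norm_num
    have hcard : (Finset.Icc 1 n \ {t}).card = n - 1 := by
      rw [Finset.card_sdiff_of_subset (by simp [ht1, htn])]
      simp
    rw [Finset.sum_congr rfl hj, Finset.sum_const, hcard, nsmul_eq_mul,
      Nat.cast_sub (by omega)]
    push_cast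
    ring
  have hmem : 1 ∈ Finset.Icc 1 (2 * n - 2) := by
    rw [Finset.mem_Icc]
    omega
  have hrest : ∑ k ∈ (Finset.Icc 1 (2 * n - 2)).erase 1, ∑ j ∈ Finset.Icc 1 n \ {t},
      (xcoord x k t j + xcoord x k j t) = 2 * (n : ℝ) - 3 := by
    rw [Finset.sum_congr rfl (g := fun _ => (1 : ℝ))]
    · rw [Finset.sum_const, Finset.card_erase_of_mem hmem, Nat.card_Icc, nsmul_eq_mul,
        show 2 * n - 2 + 1 - 1 - 1 = 2 * n - 3 by omega, Nat.cast_sub (by omega)]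
      push_cast
      ring
    · intro k hk
      rw [Finset.mem_erase, Finset.mem_Icc] at hk
      exact hslot k hk.2.1 hk.2.2 hk.1
  rw [← Finset.add_sum_erase _ _ hmem, hrest] at htotal
  linarith

end TTP
end

section
/- Let k̄ ∈ S and define the column basis B_{k̄} := {(k,i,j) ∈ M : k = k̄ or i = 1 or (i,j) = (2,3)}. Consider the linear system Cx = d over ℝ^M consisting of the equations Σ_{j ∈ V∖{i}} (x_{k,i,j} + x_{k,j,i}) = 1 for all k ∈ S with k ≥ 2 and all i ∈ V, together with Σ_{k ∈ S} x_{k,i,j} = 1 for all (i,j) ∈ A. Then |B_{k̄}| = 3n² − 4n, this equals the number of equations, and the square submatrix of C induced by the columns indexed by B_{k̄} is invertible; in particular these 3n² − 4n equations are linearly independent. -/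
open Finset

attribute [local instance] Classical.propDecidable

namespace TTP

/-- The coefficient of variable `x_m` in the equation indexed by `r`:
`Sum.inl (k,i)` is the equation `∑_{j ≠ i} (x_{k,i,j} + x_{k,j,i}) = 1`,
`Sum.inr (i,j)` is the equation `∑_{k ∈ S} x_{k,i,j} = 1`. -/
noncomputable def eqMatrix (r : (ℕ × ℕ) ⊕ (ℕ × ℕ)) (m : ℕ × ℕ × ℕ) : ℝ :=
  match r with
  | Sum.inl (k, i) => if m.1 = k ∧ (m.2.1 = i ∨ m.2.2 = i) then 1 else 0
  | Sum.inr (i, j) => if m.2.1 = i ∧ m.2.2 = j then 1 else 0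

/-- The set `M` of all matches, as a finset. -/
def matchFinset (n : ℕ) : Finset (ℕ × ℕ × ℕ) :=
  ((Finset.Icc 1 (2 * n - 2)) ×ˢ ((Finset.Icc 1 n) ×ˢ (Finset.Icc 1 n))).filter
    (fun m => m.2.1 ≠ m.2.2)

/-- The column basis `B_{k̄} = {(k,i,j) ∈ M : k = k̄ ∨ i = 1 ∨ (i,j) = (2,3)}`. -/
def basisFinset (n kbar : ℕ) : Finset (ℕ × ℕ × ℕ) :=
  (matchFinset n).filter (fun m => m.1 = kbar ∨ m.2.1 = 1 ∨ (m.2.1 = 2 ∧ m.2.2 = 3))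

/-- The row (equation) index set: team-slot equations for `k ∈ S`, `k ≥ 2`, `i ∈ V`,
together with the pair equations for `(i,j) ∈ A`. -/
def rowFinset (n : ℕ) : Finset ((ℕ × ℕ) ⊕ (ℕ × ℕ)) :=
  ((Finset.Icc 2 (2 * n - 2)) ×ˢ (Finset.Icc 1 n)).disjSum
    (((Finset.Icc 1 n) ×ˢ (Finset.Icc 1 n)).filter (fun p => p.1 ≠ p.2))

theorem card_offDiag_Icc (n : ℕ) :
    (((Finset.Icc 1 n) ×ˢ (Finset.Icc 1 n)).filter (fun p => p.1 ≠ p.2)).card = n * n - n := by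
  have h : ((Finset.Icc 1 n) ×ˢ (Finset.Icc 1 n)).filter (fun p => p.1 ≠ p.2)
      = (Finset.Icc 1 n).offDiag := by
    ext p
    simp only [mem_filter, mem_product, mem_offDiag]
    tauto
  rw [h, offDiag_card, Nat.card_Icc, Nat.add_sub_cancel]

theorem slot_count_mul_add (n : ℕ) (hn : 4 ≤ n) :
    (2 * n - 3) * n + (n * n - n) = 3 * n ^ 2 - 4 * n := by
  obtain ⟨m, rfl⟩ := Nat.exists_eq_add_of_le hn
  have h₁ : 2 * (4 + m) - 3 = 2 * m + 5 := by omega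
  have h₂ : (4 + m) * (4 + m) - (4 + m) = (4 + m) * (m + 3) :=
    Nat.sub_eq_of_eq_add (by ring)
  rw [h₁, h₂]
  exact (Nat.sub_eq_of_eq_add (by ring)).symm

theorem card_rowFinset (n : ℕ) (hn : 4 ≤ n) : (rowFinset n).card = 3 * n ^ 2 - 4 * n := by
  rw [rowFinset, card_disjSum, card_product, card_offDiag_Icc, Nat.card_Icc, Nat.card_Icc,
    ← slot_count_mul_add n hn]
  congr 2

theorem card_basisFinset (n : ℕ) (hn : 4 ≤ n) (kbar : ℕ) (hk1 : 1 ≤ kbar)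
    (hk2 : kbar ≤ 2 * n - 2) : (basisFinset n kbar).card = 3 * n ^ 2 - 4 * n := by
  have h : basisFinset n kbar =
      (((Finset.Icc 1 (2 * n - 2)).erase kbar) ×ˢ
        (insert (2, 3) (({1} : Finset ℕ) ×ˢ Finset.Icc 2 n))) ∪
      (({kbar} : Finset ℕ) ×ˢ
        (((Finset.Icc 1 n) ×ˢ (Finset.Icc 1 n)).filter (fun p => p.1 ≠ p.2))) := by
    ext ⟨k, i, j⟩
    simp only [basisFinset, matchFinset, mem_filter, mem_product, mem_union, mem_insert,
      mem_singleton, mem_erase, mem_Icc, Prod.mk.injEq]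
    by_cases hk : k = kbar <;> grind
  have hd : Disjoint
      (((Finset.Icc 1 (2 * n - 2)).erase kbar) ×ˢ
        (insert (2, 3) (({1} : Finset ℕ) ×ˢ Finset.Icc 2 n)))
      (({kbar} : Finset ℕ) ×ˢ
        (((Finset.Icc 1 n) ×ˢ (Finset.Icc 1 n)).filter (fun p => p.1 ≠ p.2))) := by
    rw [disjoint_product]
    left
    simp
  rw [h, card_union_of_disjoint hd, card_product, card_product, card_offDiag_Icc,
    card_insert_of_notMem (by simp), card_product, card_singleton, card_singleton,
    card_erase_of_mem (mem_Icc.2 ⟨hk1, hk2⟩), Nat.card_Icc, Nat.card_Icc, one_mul, one_mul,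
    ← slot_count_mul_add n hn]
  congr 2
  omega

/-- A linear combination of the equations, with coefficients supported on `rowFinset n`,
evaluated at the column of the match `(k, i, j)`. -/
theorem sum_rowFinset_mul_eqMatrix (n : ℕ) (G : (ℕ × ℕ) ⊕ (ℕ × ℕ) → ℝ)
    (hG : ∀ r, r ∉ rowFinset n → G r = 0) (k i j : ℕ) (hij : i ≠ j) :
    ∑ r ∈ rowFinset n, G r * eqMatrix r (k, i, j) =
      G (Sum.inl (k, i)) + G (Sum.inl (k, j)) + G (Sum.inr (i, j)) := by
  have h : ∀ r, G r * eqMatrix r (k, i, j) =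
      (if Sum.inl (k, i) = r then G r else 0) + (if Sum.inl (k, j) = r then G r else 0) +
        (if Sum.inr (i, j) = r then G r else 0) := by
    rintro (⟨a, b⟩ | ⟨a, b⟩) <;>
      simp only [eqMatrix, Sum.inl.injEq, Sum.inr.injEq, Prod.mk.injEq, reduceCtorEq] <;>
      grind
  have hite : ∀ r, (if r ∈ rowFinset n then G r else 0) = G r := fun r => by
    split_ifs with hr
    · rfl
    · exact (hG r hr).symm
  simp only [h, sum_add_distrib, sum_ite_eq, hite]

theorem coeff_eq_zero_of_basis_columns (n : ℕ) (hn : 4 ≤ n) (kbar : ℕ) (hk1 : 1 ≤ kbar)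
    (hk2 : kbar ≤ 2 * n - 2) (G : (ℕ × ℕ) ⊕ (ℕ × ℕ) → ℝ)
    (hG : ∀ r, r ∉ rowFinset n → G r = 0)
    (h : ∀ c ∈ basisFinset n kbar, ∑ r ∈ rowFinset n, G r * eqMatrix r c = 0) :
    ∀ r, G r = 0 := by
  have hcol : ∀ k i j, 1 ≤ k → k ≤ 2 * n - 2 → 1 ≤ i → i ≤ n → 1 ≤ j → j ≤ n → i ≠ j →
      (k = kbar ∨ i = 1 ∨ (i = 2 ∧ j = 3)) →
      G (Sum.inl (k, i)) + G (Sum.inl (k, j)) + G (Sum.inr (i, j)) = 0 := by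
    intro k i j h₁ h₂ h₃ h₄ h₅ h₆ h₇ h₈
    rw [← sum_rowFinset_mul_eqMatrix n G hG k i j h₇]
    apply h
    simp only [basisFinset, matchFinset, mem_filter, mem_product, mem_Icc]
    exact ⟨⟨⟨⟨h₁, h₂⟩, ⟨h₃, h₄⟩, h₅, h₆⟩, h₇⟩, h₈⟩
  have hconst : ∀ k i, 1 ≤ k → k ≤ 2 * n - 2 → 1 ≤ i → i ≤ n →
      G (Sum.inl (k, i)) = G (Sum.inl (kbar, i)) := by
    intro k i hk hk' hi hi'
    have hstar : ∀ j, 1 < j → j ≤ n → G (Sum.inl (k, 1)) + G (Sum.inl (k, j)) =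
        G (Sum.inl (kbar, 1)) + G (Sum.inl (kbar, j)) := by
      intro j hj hj'
      have e₁ := hcol k 1 j hk hk' le_rfl (by omega) (by omega) hj' (by omega) (by simp)
      have e₂ := hcol kbar 1 j hk1 hk2 le_rfl (by omega) (by omega) hj' (by omega) (by simp)
      linarith
    have e₁ := hcol k 2 3 hk hk' (by omega) (by omega) (by omega) (by omega) (by omega) (by simp)
    have e₂ := hcol kbar 2 3 hk1 hk2 (by omega) (by omega) (by omega) (by omega) (by omega)
      (by simp)
    have e₃ := hstar 2 (by omega) (by omega)
    have e₄ := hstar 3 (by omega) (by omega)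
    rcases hi.eq_or_lt with rfl | hlt
    · linarith
    · have e₅ := hstar i hlt hi'
      linarith
  have hfirst : ∀ i, G (Sum.inl (1, i)) = 0 := fun i => hG _ (by simp [rowFinset])
  have hslot : ∀ k i, 1 ≤ k → k ≤ 2 * n - 2 → 1 ≤ i → i ≤ n → G (Sum.inl (k, i)) = 0 := by
    intro k i hk hk' hi hi'
    rw [hconst k i hk hk' hi hi', ← hconst 1 i le_rfl (by omega) hi hi', hfirst]
  intro r
  by_cases hr : r ∈ rowFinset n
  · rcases r with ⟨k, i⟩ | ⟨i, j⟩
    · simp only [rowFinset, inl_mem_disjSum, mem_product, mem_Icc] at hr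
      exact hslot k i (by omega) hr.1.2 hr.2.1 hr.2.2
    · simp only [rowFinset, inr_mem_disjSum, mem_filter, mem_product, mem_Icc] at hr
      obtain ⟨⟨⟨hi, hi'⟩, hj, hj'⟩, hij⟩ := hr
      have e := hcol kbar i j hk1 hk2 hi hi' hj hj' hij (Or.inl rfl)
      rw [hslot kbar i hk1 hk2 hi hi', hslot kbar j hk1 hk2 hj hj'] at e
      linarith
  · exact hG r hr

theorem linearIndependent_rows_of_basisFinset_subset (n : ℕ) (hn : 4 ≤ n) (kbar : ℕ)
    (hk1 : 1 ≤ kbar) (hk2 : kbar ≤ 2 * n - 2) (s : Finset (ℕ × ℕ × ℕ))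
    (hs : basisFinset n kbar ⊆ s) :
    LinearIndependent ℝ
      (fun (r : ↥(rowFinset n)) => (fun (m : ↥s) => eqMatrix r.1 m.1)) := by
  rw [Fintype.linearIndependent_iff]
  intro g hg r
  let G : (ℕ × ℕ) ⊕ (ℕ × ℕ) → ℝ := fun r => if hr : r ∈ rowFinset n then g ⟨r, hr⟩ else 0
  have hGg : ∀ r : ↥(rowFinset n), G r.1 = g r := fun r => by simp [G]
  rw [← hGg r]
  refine coeff_eq_zero_of_basis_columns n hn kbar hk1 hk2 G (fun r hr => dif_neg hr) ?_ r.1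
  intro c hc
  have e := congrFun hg ⟨c, hs hc⟩
  simp only [Finset.sum_apply, Pi.smul_apply, smul_eq_mul, Pi.zero_apply] at e
  rw [← e, ← Finset.sum_coe_sort]
  exact Finset.sum_congr rfl fun r _ => by rw [hGg r]

theorem _root_.Matrix.mulVecLin_bijective_of_linearIndependent_row {ι κ K : Type*} [Fintype ι]
    [Fintype κ] [Field K] (A : Matrix ι κ K) (hcard : Fintype.card ι = Fintype.card κ)
    (hA : LinearIndependent K A.row) : Function.Bijective A.mulVecLin := by
  have hsurj : Function.Surjective A.mulVecLin := by
    rw [← LinearMap.range_eq_top]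
    apply Submodule.eq_top_of_finrank_eq
    rw [Module.finrank_fintype_fun_eq_card]
    exact hA.rank_matrix
  have hfr : Module.finrank K (κ → K) = Module.finrank K (ι → K) := by
    rw [Module.finrank_fintype_fun_eq_card, Module.finrank_fintype_fun_eq_card, hcard]
  exact ⟨(LinearMap.injective_iff_surjective_of_finrank_eq_finrank hfr).2 hsurj, hsurj⟩

/-- `|B_{k̄}| = 3n² - 4n`, this equals the number of equations, the square
submatrix of the equation system induced by the columns in `B_{k̄}` is invertible, and in
particular the equations (the rows of the full matrix) are linearly independent. -/
theorem basis_submatrix_invertible (n : ℕ) (hn : 4 ≤ n) (heven : Even n)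
    (kbar : ℕ) (hk1 : 1 ≤ kbar) (hk2 : kbar ≤ 2 * n - 2) :
    (basisFinset n kbar).card = 3 * n ^ 2 - 4 * n ∧
    (rowFinset n).card = 3 * n ^ 2 - 4 * n ∧
    Function.Bijective
      (Matrix.mulVecLin (Matrix.of fun (r : ↥(rowFinset n)) (c : ↥(basisFinset n kbar)) =>
        eqMatrix r.1 c.1)) ∧
    LinearIndependent ℝ
      (fun (r : ↥(rowFinset n)) => (fun (m : ↥(matchFinset n)) => eqMatrix r.1 m.1)) := by
  have hB := card_basisFinset n hn kbar hk1 hk2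
  have hR := card_rowFinset n hn
  refine ⟨hB, hR, ?_, linearIndependent_rows_of_basisFinset_subset n hn kbar hk1 hk2 _
    (filter_subset _ _)⟩
  apply Matrix.mulVecLin_bijective_of_linearIndependent_row
  · rw [Fintype.card_coe, Fintype.card_coe, hB, hR]
  · exact linearIndependent_rows_of_basisFinset_subset n hn kbar hk1 hk2 _ Subset.rfl

end TTP
end

section
/- For each (t,i,j) ∈ V × A there exists a tournament T in which team t never travels from venue i to venue j, i.e., ψ(T)_{t,i,j} = 0. -/
open Finset

attribute [local instance] Classical.propDecidable

namespace TTP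

/-- The round-robin schedule of the circle method on labels `1,…,n`: label `n` meets label `r`
in round `r`, and labels `x, y < n` meet in the round `r` with `2 r ≡ x + y` modulo `n - 1`. -/
def CircleMeets (n r x y : ℕ) : Prop :=
  x ≠ y ∧ ((x = n ∧ y = r) ∨ (y = n ∧ x = r) ∨
    (x < n ∧ y < n ∧ (x + y = 2 * r ∨ x + y + (n - 1) = 2 * r ∨ x + y = 2 * r + (n - 1))))

/-- The mirrored double round robin of the circle method; the smaller label plays at home in the
first half, the larger label in the second half. -/
def circleTournament (n : ℕ) : Set (ℕ × ℕ × ℕ) :=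
  {m | IsMatch n m ∧ ((m.1 ≤ n - 1 ∧ m.2.1 < m.2.2 ∧ CircleMeets n m.1 m.2.1 m.2.2) ∨
    (n - 1 < m.1 ∧ m.2.2 < m.2.1 ∧ CircleMeets n (m.1 - (n - 1)) m.2.1 m.2.2))}

lemma CircleMeets.symm {n r x y : ℕ} (h : CircleMeets n r x y) : CircleMeets n r y x := by
  unfold CircleMeets at *; omega

lemma exists_circleMeets_opponent {n r x : ℕ} (heven : Even n) (hr1 : 1 ≤ r) (hrn : r ≤ n - 1)
    (hx1 : 1 ≤ x) (hxn : x ≤ n) : ∃ y, 1 ≤ y ∧ y ≤ n ∧ CircleMeets n r x y := by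
  obtain ⟨m, rfl⟩ := heven
  unfold CircleMeets
  by_cases hx : x = m + m
  · exact ⟨r, by omega⟩
  by_cases hxr : x = r
  · exact ⟨m + m, by omega⟩
  by_cases h1 : 2 * r ≤ x
  · exact ⟨2 * r + (m + m - 1) - x, by omega⟩
  by_cases h2 : 2 * r ≤ x + (m + m - 1)
  · exact ⟨2 * r - x, by omega⟩
  · exact ⟨2 * r - x - (m + m - 1), by omega⟩

lemma CircleMeets.opponent_unique {n r x y z : ℕ} (heven : Even n)
    (hr1 : 1 ≤ r) (hrn : r ≤ n - 1) (hx1 : 1 ≤ x) (hy1 : 1 ≤ y) (hz1 : 1 ≤ z)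
    (hy : CircleMeets n r x y) (hz : CircleMeets n r x z) : y = z := by
  obtain ⟨m, rfl⟩ := heven
  unfold CircleMeets at *
  omega

lemma exists_circleMeets_round {n x y : ℕ} (heven : Even n) (hx1 : 1 ≤ x) (hxn : x ≤ n)
    (hy1 : 1 ≤ y) (hyn : y ≤ n) (hxy : x ≠ y) :
    ∃ r, 1 ≤ r ∧ r ≤ n - 1 ∧ CircleMeets n r x y := by
  obtain ⟨m, rfl⟩ := heven
  unfold CircleMeets
  by_cases hx : x = m + m
  · exact ⟨y, by omega⟩
  by_cases hy : y = m + m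
  · exact ⟨x, by omega⟩
  by_cases h1 : (x + y) % 2 = 0
  · exact ⟨(x + y) / 2, by omega⟩
  by_cases h2 : x + y ≤ m + m - 1
  · exact ⟨(x + y + (m + m - 1)) / 2, by omega⟩
  · exact ⟨(x + y - (m + m - 1)) / 2, by omega⟩

lemma CircleMeets.round_unique {n x y r s : ℕ} (heven : Even n)
    (hr1 : 1 ≤ r) (hrn : r ≤ n - 1) (hs1 : 1 ≤ s) (hsn : s ≤ n - 1)
    (hr : CircleMeets n r x y) (hs : CircleMeets n s x y) : r = s := by
  obtain ⟨m, rfl⟩ := heven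
  unfold CircleMeets at *
  omega

lemma isTournament_circleTournament {n : ℕ} (heven : Even n) :
    IsTournament n (circleTournament n) where
  subset m hm := hm.1
  slot_team k hk1 hkn t ht1 htn := by
    by_cases hk : k ≤ n - 1
    · obtain ⟨y, hy1, hyn, hy⟩ := exists_circleMeets_opponent heven hk1 hk ht1 htn
      have hty := hy.1
      refine ⟨(k, min t y, max t y), ?_, ?_⟩
      · rcases lt_or_gt_of_ne hty with h | h
        · rw [min_eq_left h.le, max_eq_right h.le]
          refine ⟨⟨?_, Or.inl ⟨hk, h, hy⟩⟩, rfl, Or.inl rfl⟩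
          simp only [IsMatch]; omega
        · rw [min_eq_right h.le, max_eq_left h.le]
          refine ⟨⟨?_, Or.inl ⟨hk, h, hy.symm⟩⟩, rfl, Or.inr rfl⟩
          simp only [IsMatch]; omega
      · rintro ⟨k', a, b⟩ ⟨⟨hm, hT⟩, rfl, hab⟩
        simp only [IsMatch] at hm hT hab hk
        obtain ⟨-, hlt, hmeet⟩ : _ ∧ a < b ∧ CircleMeets n k' a b := by
          rcases hT with h | h
          · exact h
          · omega
        rcases hab with rfl | rfl
        · have := CircleMeets.opponent_unique heven hk1 hk ht1 hy1 (by omega) hy hmeet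
          subst this
          rw [min_eq_left hlt.le, max_eq_right hlt.le]
        · have := CircleMeets.opponent_unique heven hk1 hk ht1 hy1 (by omega) hy hmeet.symm
          subst this
          rw [min_eq_right hlt.le, max_eq_left hlt.le]
    · have hr1 : 1 ≤ k - (n - 1) := by omega
      have hr : k - (n - 1) ≤ n - 1 := by omega
      obtain ⟨y, hy1, hyn, hy⟩ := exists_circleMeets_opponent heven hr1 hr ht1 htn
      have hty := hy.1
      refine ⟨(k, max t y, min t y), ?_, ?_⟩
      · rcases lt_or_gt_of_ne hty with h | h
        · rw [min_eq_left h.le, max_eq_right h.le]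
          refine ⟨⟨?_, Or.inr ⟨not_le.1 hk, h, hy.symm⟩⟩, rfl, Or.inr rfl⟩
          simp only [IsMatch]; omega
        · rw [min_eq_right h.le, max_eq_left h.le]
          refine ⟨⟨?_, Or.inr ⟨not_le.1 hk, h, hy⟩⟩, rfl, Or.inl rfl⟩
          simp only [IsMatch]; omega
      · rintro ⟨k', a, b⟩ ⟨⟨hm, hT⟩, rfl, hab⟩
        simp only [IsMatch] at hm hT hab hk hr hr1 hy
        obtain ⟨-, hlt, hmeet⟩ : _ ∧ b < a ∧ CircleMeets n (k' - (n - 1)) a b := by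
          rcases hT with h | h
          · omega
          · exact h
        rcases hab with rfl | rfl
        · have := CircleMeets.opponent_unique heven hr1 hr ht1 hy1 (by omega) hy hmeet
          subst this
          rw [min_eq_right hlt.le, max_eq_left hlt.le]
        · have := CircleMeets.opponent_unique heven hr1 hr ht1 hy1 (by omega) hy hmeet.symm
          subst this
          rw [min_eq_left hlt.le, max_eq_right hlt.le]
  pair x y hx1 hxn hy1 hyn hxy := by
    obtain ⟨r, hr1, hrn, hr⟩ := exists_circleMeets_round heven hx1 hxn hy1 hyn hxy
    rcases lt_or_gt_of_ne hxy with h | h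
    · refine ⟨r, ⟨?_, Or.inl ⟨hrn, h, hr⟩⟩, ?_⟩
      · simp only [IsMatch]; omega
      · rintro k ⟨hm, hT⟩
        simp only [IsMatch] at hm hT
        rcases hT with ⟨hk, -, hmeet⟩ | hT
        · exact hmeet.round_unique heven hm.1 hk hr1 hrn hr
        · omega
    · refine ⟨r + (n - 1), ⟨?_, Or.inr ⟨?_, h, ?_⟩⟩, ?_⟩
      · simp only [IsMatch]; omega
      · show n - 1 < r + (n - 1)
        omega
      · simpa using hr
      · rintro k ⟨hm, hT⟩
        simp only [IsMatch] at hm hT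
        rcases hT with hT | ⟨hk, -, hmeet⟩
        · omega
        · have := hmeet.round_unique heven (by omega) (by omega) hr1 hrn hr
          omega

/-- Relabelling the teams of a tournament yields a tournament. -/
lemma IsTournament.relabel {n : ℕ} {T : Set (ℕ × ℕ × ℕ)} (hT : IsTournament n T)
    (σ : Equiv.Perm ℕ) (hσ : ∀ u, (1 ≤ σ u ∧ σ u ≤ n) ↔ (1 ≤ u ∧ u ≤ n)) :
    IsTournament n {m | (m.1, σ m.2.1, σ m.2.2) ∈ T} where
  subset := by
    rintro ⟨k, a, b⟩ hm
    obtain ⟨h1, h2, h3, h4, h5, h6, h7⟩ := hT.subset _ hm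
    obtain ⟨ha1, han⟩ := (hσ a).1 ⟨h3, h4⟩
    obtain ⟨hb1, hbn⟩ := (hσ b).1 ⟨h5, h6⟩
    exact ⟨h1, h2, ha1, han, hb1, hbn, fun h => h7 (congrArg σ h)⟩
  slot_team k hk1 hkn t ht1 htn := by
    obtain ⟨h1, h2⟩ := (hσ t).2 ⟨ht1, htn⟩
    obtain ⟨⟨k', a, b⟩, ⟨hm, hk, hab⟩, huniq⟩ := hT.slot_team k hk1 hkn (σ t) h1 h2
    refine ⟨(k', σ.symm a, σ.symm b), ⟨by simpa using hm, hk, ?_⟩, ?_⟩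
    · simpa [Equiv.eq_symm_apply] using hab
    · rintro ⟨l, c, d⟩ ⟨hcd, hl, htcd⟩
      have := huniq (l, σ c, σ d) ⟨hcd, hl, by simpa using htcd⟩
      simp only [Prod.mk.injEq] at this
      obtain ⟨rfl, rfl, rfl⟩ := this
      simp
  pair i j hi1 hin hj1 hjn hij := by
    obtain ⟨h1, h2⟩ := (hσ i).2 ⟨hi1, hin⟩
    obtain ⟨h3, h4⟩ := (hσ j).2 ⟨hj1, hjn⟩
    exact hT.pair (σ i) (σ j) h1 h2 h3 h4 (σ.injective.ne hij)

/-- The venue of a team that has a match is the home venue of one of its matches. -/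
lemma venue_spec {T : Set (ℕ × ℕ × ℕ)} {t k : ℕ}
    (h : ∃ i, ∃ j, (k, i, j) ∈ T ∧ (t = i ∨ t = j)) :
    ∃ j, (k, venue T t k, j) ∈ T ∧ (t = venue T t k ∨ t = j) := by
  unfold venue
  rw [dif_pos h]
  exact h.choose_spec

lemma venue_of_not_slot {n : ℕ} {T : Set (ℕ × ℕ × ℕ)} (hT : IsTournament n T) {t k : ℕ}
    (hk : k = 0 ∨ 2 * n - 2 < k) : venue T t k = t := by
  unfold venue
  rw [dif_neg]
  rintro ⟨i, j, hm, -⟩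
  obtain ⟨h1, h2, -⟩ := hT.subset _ hm
  simp only at h1 h2
  omega

lemma IsTournament.exists_venue {n : ℕ} {T : Set (ℕ × ℕ × ℕ)} (hT : IsTournament n T) {t k : ℕ}
    (ht1 : 1 ≤ t) (htn : t ≤ n) (hk1 : 1 ≤ k) (hkn : k ≤ 2 * n - 2) :
    ∃ j, (k, venue T t k, j) ∈ T ∧ (t = venue T t k ∨ t = j) := by
  obtain ⟨⟨k', a, b⟩, ⟨hm, rfl, hab⟩, -⟩ := hT.slot_team k hk1 hkn t ht1 htn
  exact venue_spec ⟨a, b, hm, hab⟩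

/-- A permutation of `{1,…,n}` with two prescribed values. -/
lemma exists_perm_apply_eq_apply_eq {n t u p q : ℕ} (ht1 : 1 ≤ t) (htn : t ≤ n)
    (hu1 : 1 ≤ u) (hun : u ≤ n) (hp1 : 1 ≤ p) (hpn : p ≤ n) (hq1 : 1 ≤ q) (hqn : q ≤ n)
    (htu : t ≠ u) (hpq : p ≠ q) :
    ∃ σ : Equiv.Perm ℕ, (∀ v, (1 ≤ σ v ∧ σ v ≤ n) ↔ (1 ≤ v ∧ v ≤ n)) ∧ σ t = p ∧ σ u = q := by
  have hswap : ∀ a b v, 1 ≤ a → a ≤ n → 1 ≤ b → b ≤ n →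
      ((1 ≤ Equiv.swap a b v ∧ Equiv.swap a b v ≤ n) ↔ (1 ≤ v ∧ v ≤ n)) := by
    intro a b v ha1 han hb1 hbn
    rw [Equiv.swap_apply_def]
    split_ifs <;> omega
  obtain ⟨hw1, hwn⟩ := (hswap t p u ht1 htn hp1 hpn).2 ⟨hu1, hun⟩
  have hpw : p ≠ Equiv.swap t p u := by
    intro h
    exact htu ((Equiv.swap t p).injective ((Equiv.swap_apply_left t p).trans h))
  refine ⟨Equiv.swap (Equiv.swap t p u) q * Equiv.swap t p, fun v => ?_, ?_, ?_⟩
  · rw [Equiv.Perm.mul_apply, hswap _ _ _ hw1 hwn hq1 hqn, hswap _ _ _ ht1 htn hp1 hpn]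
  · rw [Equiv.Perm.mul_apply, Equiv.swap_apply_left, Equiv.swap_apply_of_ne_of_ne hpw hpq]
  · rw [Equiv.Perm.mul_apply, Equiv.swap_apply_left]

/-- for each `(t,i,j) ∈ V × A` there is a tournament in which team `t`
never travels from venue `i` to venue `j`. -/
theorem exists_tournament_no_travel (n : ℕ) (hn : 4 ≤ n) (heven : Even n)
    (t i j : ℕ) (ht1 : 1 ≤ t) (htn : t ≤ n) (hi1 : 1 ≤ i) (hin : i ≤ n)
    (hj1 : 1 ≤ j) (hjn : j ≤ n) (hij : i ≠ j) :
    ∃ T : Set (ℕ × ℕ × ℕ), IsTournament n T ∧ travel n T (t, i, j) = 0 := by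
  obtain ⟨σ, hσ, hσt, hσij⟩ : ∃ σ : Equiv.Perm ℕ,
      (∀ v, (1 ≤ σ v ∧ σ v ≤ n) ↔ (1 ≤ v ∧ v ≤ n)) ∧ σ t = n ∧
      ((i = t ∧ σ j = 2) ∨ (j = t ∧ σ i = 1) ∨ (i ≠ t ∧ j ≠ t ∧ σ i = n - 1)) := by
    by_cases hit : i = t
    · obtain ⟨σ, h, h1, h2⟩ := exists_perm_apply_eq_apply_eq (p := n) (q := 2) ht1 htn hj1 hjn
        (by omega) (by omega) (by omega) (by omega) (by omega) (by omega)
      exact ⟨σ, h, h1, Or.inl ⟨hit, h2⟩⟩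
    by_cases hjt : j = t
    · obtain ⟨σ, h, h1, h2⟩ := exists_perm_apply_eq_apply_eq (p := n) (q := 1) ht1 htn hi1 hin
        (by omega) (by omega) (by omega) (by omega) (by omega) (by omega)
      exact ⟨σ, h, h1, Or.inr (Or.inl ⟨hjt, h2⟩)⟩
    · obtain ⟨σ, h, h1, h2⟩ := exists_perm_apply_eq_apply_eq (p := n) (q := n - 1) ht1 htn hi1 hin
        (by omega) (by omega) (by omega) (by omega) (by omega) (by omega)
      exact ⟨σ, h, h1, Or.inr (Or.inr ⟨hit, hjt, h2⟩)⟩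
  have hT := (isTournament_circleTournament heven).relabel σ hσ
  refine ⟨_, hT, ?_⟩
  set T := {m : ℕ × ℕ × ℕ | (m.1, σ m.2.1, σ m.2.2) ∈ circleTournament n}
  have first_half : ∀ k, 1 ≤ k → k ≤ n - 1 → σ (venue T t k) = k := by
    intro k hk1 hkn
    obtain ⟨b, hm, hb⟩ := hT.exists_venue ht1 htn hk1 (by omega)
    generalize venue T t k = a at hm hb
    obtain ⟨hM, hm⟩ := hm
    simp only [IsMatch, CircleMeets] at hM hm
    rcases hb with rfl | rfl <;> omega
  have second_half : ∀ k, n - 1 < k → venue T t k = t := by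
    intro k hk
    by_cases hkn : k ≤ 2 * n - 2
    · obtain ⟨b, hm, hb⟩ := hT.exists_venue ht1 htn (by omega) hkn
      generalize venue T t k = a at hm hb
      obtain ⟨hM, hm⟩ := hm
      simp only [IsMatch, CircleMeets] at hM hm
      rcases hb with rfl | rfl
      · rfl
      · omega
    · exact venue_of_not_slot hT (Or.inr (not_le.1 hkn))
  unfold travel
  rw [if_neg]
  rintro ⟨k, -, hki, hkj⟩
  simp only at hki hkj
  rcases Nat.eq_zero_or_pos k with rfl | hk
  · have hi := venue_of_not_slot hT (t := t) (k := 0) (Or.inl rfl)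
    have hj := first_half 1 le_rfl (by omega)
    rw [hki] at hi
    rw [hkj] at hj
    omega
  by_cases hkn : k ≤ n - 1
  · have hi := first_half k hk hkn
    rw [hki] at hi
    by_cases hkn' : k + 1 ≤ n - 1
    · have hj := first_half (k + 1) (by omega) hkn'
      rw [hkj] at hj
      rcases hσij with ⟨rfl, h⟩ | ⟨rfl, h⟩ | h <;> omega
    · have hj := second_half (k + 1) (by omega)
      rw [hkj] at hj
      rcases hσij with ⟨rfl, h⟩ | h | h <;> omega
  · have hi := second_half k (by omega)
    have hj := second_half (k + 1) (by omega)
    omega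

end TTP
end

section
/- For each slot k ∈ S∖{1} and all distinct teams i,j ∈ V there exist tournaments T and T' with (1,i,j), (k,j,i) ∈ T and T' = T ∖ {(1,i,j),(k,j,i)} ∪ {(1,j,i),(k,i,j)}; in particular there exists a tournament containing both matches (1,i,j) and (k,j,i). -/
open Finset

attribute [local instance] Classical.propDecidable

namespace TTP

/-- A slot function on `{1,…,n}`: `s a b` is the slot in which `b` visits `a`. -/
structure IsSlotFun (n : ℕ) (s : ℕ → ℕ → ℕ) : Prop where
  mem : ∀ a b, 1 ≤ a → a ≤ n → 1 ≤ b → b ≤ n → a ≠ b → 1 ≤ s a b ∧ s a b ≤ 2 * n - 2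
  ne : ∀ a b, 1 ≤ a → a ≤ n → 1 ≤ b → b ≤ n → a ≠ b → s a b ≠ s b a
  opponent : ∀ k, 1 ≤ k → k ≤ 2 * n - 2 → ∀ t, 1 ≤ t → t ≤ n →
    ∃! b, (1 ≤ b ∧ b ≤ n ∧ t ≠ b) ∧ (s t b = k ∨ s b t = k)

/-- The set of matches scheduled by a slot function. -/
def matchesOf (n : ℕ) (s : ℕ → ℕ → ℕ) : Set (ℕ × ℕ × ℕ) :=
  {m | (1 ≤ m.2.1 ∧ m.2.1 ≤ n ∧ 1 ≤ m.2.2 ∧ m.2.2 ≤ n ∧ m.2.1 ≠ m.2.2) ∧ s m.2.1 m.2.2 = m.1}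

theorem IsSlotFun.isTournament {n : ℕ} {s : ℕ → ℕ → ℕ} (hs : IsSlotFun n s) :
    IsTournament n (matchesOf n s) where
  subset := by
    rintro ⟨k, a, b⟩ ⟨⟨h1, h2, h3, h4, h5⟩, h6⟩
    have := hs.mem a b h1 h2 h3 h4 h5
    exact ⟨h6 ▸ this.1, h6 ▸ this.2, h1, h2, h3, h4, h5⟩
  slot_team := by
    intro k hk1 hk2 t ht1 ht2
    obtain ⟨b, ⟨⟨hb1, hb2, hb3⟩, hb⟩, hu⟩ := hs.opponent k hk1 hk2 t ht1 ht2
    have hne := hs.ne t b ht1 ht2 hb1 hb2 hb3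
    have key : ∀ m : ℕ × ℕ × ℕ, m ∈ matchesOf n s → m.1 = k → (t = m.2.1 ∨ t = m.2.2) →
        (m = (k, t, b) ∧ s t b = k) ∨ (m = (k, b, t) ∧ s b t = k) := by
      rintro ⟨k', x, y⟩ ⟨⟨h1, h2, h3, h4, h5⟩, h6⟩ h7 h8
      simp only at h1 h2 h3 h4 h5 h6 h7 h8
      subst h7
      rcases h8 with rfl | rfl
      · obtain rfl := hu y ⟨⟨h3, h4, h5⟩, Or.inl h6⟩
        exact Or.inl ⟨rfl, h6⟩
      · obtain rfl := hu x ⟨⟨h1, h2, h5.symm⟩, Or.inr h6⟩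
        exact Or.inr ⟨rfl, h6⟩
    rcases hb with hb | hb
    · refine ⟨(k, t, b), ⟨⟨⟨ht1, ht2, hb1, hb2, hb3⟩, hb⟩, rfl, Or.inl rfl⟩, ?_⟩
      rintro m ⟨hm, hmk, hmt⟩
      rcases key m hm hmk hmt with h | h
      · exact h.1
      · exact absurd (hb.trans h.2.symm) hne
    · refine ⟨(k, b, t), ⟨⟨⟨hb1, hb2, ht1, ht2, hb3.symm⟩, hb⟩, rfl, Or.inr rfl⟩, ?_⟩
      rintro m ⟨hm, hmk, hmt⟩
      rcases key m hm hmk hmt with h | h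
      · exact absurd (h.2.trans hb.symm) hne
      · exact h.1
  pair := fun a b h1 h2 h3 h4 h5 =>
    ⟨s a b, ⟨⟨h1, h2, h3, h4, h5⟩, rfl⟩, fun _ h => h.2.symm⟩

/-- Permuting the slots of a slot function yields a slot function. -/
theorem IsSlotFun.perm {n : ℕ} {s : ℕ → ℕ → ℕ} (hs : IsSlotFun n s) (σ : Equiv.Perm ℕ)
    (hσ : ∀ x, (1 ≤ σ x ∧ σ x ≤ 2 * n - 2) ↔ (1 ≤ x ∧ x ≤ 2 * n - 2)) :
    IsSlotFun n (fun a b => σ (s a b)) where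
  mem a b h1 h2 h3 h4 h5 := (hσ _).2 (hs.mem a b h1 h2 h3 h4 h5)
  ne a b h1 h2 h3 h4 h5 h := hs.ne a b h1 h2 h3 h4 h5 (σ.injective h)
  opponent k hk1 hk2 t ht1 ht2 := by
    have h := (hσ (σ.symm k)).1 (by simpa using ⟨hk1, hk2⟩)
    simpa only [Equiv.eq_symm_apply] using hs.opponent (σ.symm k) h.1 h.2 t ht1 ht2

/-- The slot function with the two matches between `i` and `j` interchanged. -/
def swapPair (s : ℕ → ℕ → ℕ) (i j a b : ℕ) : ℕ :=
  if (a = i ∧ b = j) ∨ (a = j ∧ b = i) then s b a else s a b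

theorem IsSlotFun.swapPair {n : ℕ} {s : ℕ → ℕ → ℕ} (hs : IsSlotFun n s) (i j : ℕ) :
    IsSlotFun n (swapPair s i j) := by
  have key : ∀ a b, (TTP.swapPair s i j a b = s a b ∧ TTP.swapPair s i j b a = s b a) ∨
      (TTP.swapPair s i j a b = s b a ∧ TTP.swapPair s i j b a = s a b) := by
    intro a b
    unfold TTP.swapPair
    grind
  refine ⟨fun a b h1 h2 h3 h4 h5 => ?_, fun a b h1 h2 h3 h4 h5 => ?_,
    fun k hk1 hk2 t ht1 ht2 => ?_⟩
  · rcases key a b with h | h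
    · rw [h.1]
      exact hs.mem a b h1 h2 h3 h4 h5
    · rw [h.1]
      exact hs.mem b a h3 h4 h1 h2 h5.symm
  · have := hs.ne a b h1 h2 h3 h4 h5
    rcases key a b with h | h <;> rw [h.1, h.2]
    · exact this
    · exact this.symm
  · have e : ∀ b, (TTP.swapPair s i j t b = k ∨ TTP.swapPair s i j b t = k) ↔
        (s t b = k ∨ s b t = k) := by
      intro b
      rcases key t b with h | h <;> rw [h.1, h.2]
      exact or_comm
    simpa only [e] using hs.opponent k hk1 hk2 t ht1 ht2

/-- Interchanging the two matches between `i` and `j` is a home-away swap. -/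
theorem matchesOf_swapPair {n : ℕ} {s : ℕ → ℕ → ℕ} (hs : IsSlotFun n s) {i j : ℕ}
    (hi1 : 1 ≤ i) (hin : i ≤ n) (hj1 : 1 ≤ j) (hjn : j ≤ n) (hij : i ≠ j) :
    matchesOf n (swapPair s i j) =
      matchesOf n s \ {(s i j, i, j), (s j i, j, i)} ∪ {(s i j, j, i), (s j i, i, j)} := by
  have hne := hs.ne i j hi1 hin hj1 hjn hij
  ext ⟨k, a, b⟩
  simp only [matchesOf, swapPair, Set.mem_ofPred_eq, Set.mem_union, Set.mem_sdiff,
    Set.mem_insert_iff, Set.mem_singleton_iff, Prod.mk.injEq]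
  grind

/-- The circle-method 1-factorization of the complete graph on `{1,…,n}`, `n` even: the colour
in `{1,…,n-1}` of the edge `ab`. -/
def circleColor (n a b : ℕ) : ℕ :=
  if (if a = n then b else a) + (if b = n then a else b) < n then
    (if a = n then b else a) + (if b = n then a else b)
  else (if a = n then b else a) + (if b = n then a else b) + 1 - n

theorem circleColor_comm (n a b : ℕ) : circleColor n a b = circleColor n b a := by
  unfold circleColor
  split_ifs <;> omega

theorem circleColor_mem {n a b : ℕ} (h1 : 1 ≤ a) (h2 : a ≤ n) (h3 : 1 ≤ b) (h4 : b ≤ n)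
    (h5 : a ≠ b) : 1 ≤ circleColor n a b ∧ circleColor n a b < n := by
  unfold circleColor
  split_ifs <;> omega

theorem circleColor_existsUnique {n : ℕ} (hn : 2 ≤ n) (heven : Even n) {r t : ℕ}
    (hr1 : 1 ≤ r) (hrn : r < n) (ht1 : 1 ≤ t) (htn : t ≤ n) :
    ∃! b, (1 ≤ b ∧ b ≤ n ∧ t ≠ b) ∧ circleColor n t b = r := by
  obtain ⟨h, rfl⟩ := heven
  have uniq : ∀ b b', (1 ≤ b ∧ b ≤ h + h ∧ t ≠ b) ∧ circleColor (h + h) t b = r →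
      (1 ≤ b' ∧ b' ≤ h + h ∧ t ≠ b') ∧ circleColor (h + h) t b' = r → b = b' := by
    unfold circleColor
    intro b b' hb hb'
    split_ifs at hb hb' <;> omega
  refine existsUnique_of_exists_of_unique ?_ uniq
  by_cases ht : t = h + h
  · refine ⟨if r % 2 = 0 then r / 2 else (r + (h + h - 1)) / 2, ?_⟩
    unfold circleColor
    split_ifs <;> omega
  · by_cases hrt : t < r
    · by_cases e : r = t + t
      · refine ⟨h + h, ?_⟩
        unfold circleColor
        split_ifs <;> omega
      · refine ⟨r - t, ?_⟩
        unfold circleColor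
        split_ifs <;> omega
    · by_cases e : r + (h + h - 1) = t + t
      · refine ⟨h + h, ?_⟩
        unfold circleColor
        split_ifs <;> omega
      · refine ⟨r + (h + h - 1) - t, ?_⟩
        unfold circleColor
        split_ifs <;> omega

/-- The mirrored double round-robin schedule built from `circleColor`. -/
def circleSlot (n a b : ℕ) : ℕ :=
  if a < b then circleColor n a b else circleColor n a b + (n - 1)

theorem isSlotFun_circleSlot {n : ℕ} (hn : 2 ≤ n) (heven : Even n) :
    IsSlotFun n (circleSlot n) where
  mem a b h1 h2 h3 h4 h5 := by
    have := circleColor_mem h1 h2 h3 h4 h5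
    unfold circleSlot
    split_ifs <;> omega
  ne a b h1 h2 h3 h4 h5 := by
    have := circleColor_comm n a b
    unfold circleSlot
    split_ifs <;> omega
  opponent k hk1 hk2 t ht1 ht2 := by
    have e : ∀ b, ((1 ≤ b ∧ b ≤ n ∧ t ≠ b) ∧ (circleSlot n t b = k ∨ circleSlot n b t = k)) ↔
        ((1 ≤ b ∧ b ≤ n ∧ t ≠ b) ∧ circleColor n t b = if k < n then k else k - (n - 1)) := by
      refine fun b => and_congr_right fun hb => ?_
      have h1 := circleColor_comm n t b
      have h2 := circleColor_mem ht1 ht2 hb.1 hb.2.1 hb.2.2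
      unfold circleSlot
      split_ifs <;> omega
    simp only [e]
    apply circleColor_existsUnique hn heven _ _ ht1 ht2 <;> split_ifs <;> omega

theorem swap_mem_iff {N p q : ℕ} (hp1 : 1 ≤ p) (hp : p ≤ N) (hq1 : 1 ≤ q) (hq : q ≤ N) (x : ℕ) :
    (1 ≤ Equiv.swap p q x ∧ Equiv.swap p q x ≤ N) ↔ (1 ≤ x ∧ x ≤ N) := by
  rw [Equiv.swap_apply_def]
  split_ifs <;> omega

/-- home-away swaps exist for every slot `k ∈ S∖{1}` and distinct teams. -/
theorem exists_home_away_swap (n : ℕ) (hn : 4 ≤ n) (heven : Even n)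
    (k : ℕ) (hk1 : 1 ≤ k) (hk2 : k ≤ 2 * n - 2) (hk3 : k ≠ 1)
    (i j : ℕ) (hi1 : 1 ≤ i) (hin : i ≤ n) (hj1 : 1 ≤ j) (hjn : j ≤ n) (hij : i ≠ j) :
    ∃ T T' : Set (ℕ × ℕ × ℕ), IsTournament n T ∧ IsTournament n T' ∧
      (1, i, j) ∈ T ∧ (k, j, i) ∈ T ∧
      T' = T \ {(1, i, j), (k, j, i)} ∪ {(1, j, i), (k, i, j)} := by
  have h0 := isSlotFun_circleSlot (n := n) (by omega) heven
  obtain ⟨hp1, hp2⟩ := h0.mem i j hi1 hin hj1 hjn hij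
  obtain ⟨hq1, hq2⟩ := h0.mem j i hj1 hjn hi1 hin hij.symm
  have hpq := h0.ne i j hi1 hin hj1 hjn hij
  have h1 := h0.perm (Equiv.swap (circleSlot n i j) 1)
    (swap_mem_iff hp1 hp2 le_rfl (by omega))
  obtain ⟨hq1', hq2'⟩ := h1.mem j i hj1 hjn hi1 hin hij.symm
  have hpq' := h1.ne i j hi1 hin hj1 hjn hij
  have h2 := h1.perm (Equiv.swap (Equiv.swap (circleSlot n i j) 1 (circleSlot n j i)) k)
    (swap_mem_iff hq1' hq2' hk1 hk2)
  simp only [Equiv.swap_apply_left] at hpq'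
  set s : ℕ → ℕ → ℕ := fun a b =>
    Equiv.swap (Equiv.swap (circleSlot n i j) 1 (circleSlot n j i)) k
      (Equiv.swap (circleSlot n i j) 1 (circleSlot n a b)) with hs
  have hsij : s i j = 1 := by
    simp only [hs, Equiv.swap_apply_left]
    exact Equiv.swap_apply_of_ne_of_ne hpq' hk3.symm
  have hsji : s j i = k := by simp only [hs, Equiv.swap_apply_left]
  refine ⟨matchesOf n s, matchesOf n (swapPair s i j), h2.isTournament,
    (h2.swapPair i j).isTournament, ⟨⟨hi1, hin, hj1, hjn, hij⟩, hsij⟩,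
    ⟨⟨hj1, hjn, hi1, hin, hij.symm⟩, hsji⟩, ?_⟩
  have h := matchesOf_swapPair h2 hi1 hin hj1 hjn hij
  rwa [hsij, hsji] at h

end TTP
end

section
/- The affine hull of Ptt(n) equals the set of all (x,y) ∈ ℝ^M × ℝ^{V×A} satisfying Σ_{j ∈ V∖{i}} (x_{k,i,j} + x_{k,j,i}) = 1 for all k ∈ S and all i ∈ V, and Σ_{k ∈ S} x_{k,i,j} = 1 for all (i,j) ∈ A. -/
open Finset

attribute [local instance] Classical.propDecidable

namespace TTP

/-- The set `A` of ordered pairs of distinct teams. -/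
def arcs (n : ℕ) : Finset (ℕ × ℕ) := (Icc 1 n).offDiag

/-- The set `S` of slots. -/
def slots (n : ℕ) : Finset ℕ := Icc 1 (2 * n - 2)

/-- An assignment of slots to ordered pairs in which pairs with a common team get different slots;
by counting, this encodes a tournament. -/
structure IsSched (n : ℕ) (s : ℕ × ℕ → ℕ) : Prop where
  mem : ∀ a ∈ arcs n, s a ∈ slots n
  inj : ∀ a ∈ arcs n, ∀ b ∈ arcs n, s a = s b →
    (a.1 = b.1 ∨ a.1 = b.2 ∨ a.2 = b.1 ∨ a.2 = b.2) → a = b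

/-- A proper edge colouring of the complete graph on `{1,…,n}` with colours `1,…,n-1`. -/
structure IsCol (n : ℕ) (f : ℕ × ℕ → ℕ) : Prop where
  mem : ∀ a ∈ arcs n, f a ∈ Icc 1 (n - 1)
  symm : ∀ i j, f (j, i) = f (i, j)
  inj : ∀ i j j', (i, j) ∈ arcs n → (i, j') ∈ arcs n → f (i, j) = f (i, j') → j = j'

lemma mem_arcs {n i j : ℕ} :
    (i, j) ∈ arcs n ↔ (1 ≤ i ∧ i ≤ n) ∧ (1 ≤ j ∧ j ≤ n) ∧ i ≠ j := by
  simp [arcs, mem_offDiag]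

lemma mem_slots {n k : ℕ} : k ∈ slots n ↔ 1 ≤ k ∧ k ≤ 2 * n - 2 := by
  simp [slots]

lemma eq_of_modEq {m i j : ℕ} (hi : 1 ≤ i) (hi' : i ≤ m) (hj : 1 ≤ j) (hj' : j ≤ m)
    (h : i ≡ j [MOD m]) : i = j := by
  have h' := (Nat.modEq_iff_dvd.1 h)
  have := Int.eq_zero_of_abs_lt_dvd h' (by rw [abs_lt]; constructor <;> omega)
  omega

/-- The circle method. -/
lemma exists_isCol {n : ℕ} (hn : 4 ≤ n) (he : Even n) : ∃ f, IsCol n f := by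
  refine ⟨fun a => 1 + (if a.1 = n then 2 * a.2 else if a.2 = n then 2 * a.1 else a.1 + a.2)
    % (n - 1), ?_, ?_, ?_⟩
  · intro a _
    rw [mem_Icc]
    have := Nat.mod_lt (if a.1 = n then 2 * a.2 else if a.2 = n then 2 * a.1 else a.1 + a.2)
      (show 0 < n - 1 by omega)
    omega
  · intro i j
    dsimp only
    congr 2
    split_ifs <;> omega
  · intro i j j' h h' hf
    rw [mem_arcs] at h h'
    dsimp only at hf
    have hm := Nat.add_left_cancel hf
    change _ ≡ _ [MOD n - 1] at hm
    have hc : Nat.gcd (n - 1) 2 = 1 := by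
      have : Odd (n - 1) := Nat.Even.sub_odd (by omega) he odd_one
      exact Nat.coprime_two_right.2 this
    split_ifs at hm with h1 h2 h3 h3
    · exact eq_of_modEq (m := n - 1) (by omega) (by omega) (by omega) (by omega)
        (Nat.ModEq.cancel_left_of_coprime hc hm)
    · omega
    · rw [two_mul] at hm
      have := eq_of_modEq (m := n - 1) (by omega) (by omega) (by omega) (by omega)
        (Nat.ModEq.add_left_cancel' i hm)
      omega
    · rw [two_mul] at hm
      have := eq_of_modEq (m := n - 1) (by omega) (by omega) (by omega) (by omega)
        (Nat.ModEq.add_left_cancel' i hm)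
      omega
    · exact eq_of_modEq (m := n - 1) (by omega) (by omega) (by omega) (by omega)
        (Nat.ModEq.add_left_cancel' i hm)

lemma IsCol.comp_perm {n : ℕ} {f : ℕ × ℕ → ℕ} (hf : IsCol n f) (π : Equiv.Perm ℕ)
    (hπ : ∀ i ∈ Icc 1 n, π i ∈ Icc 1 n) : IsCol n (fun a => f (π a.1, π a.2)) := by
  have key : ∀ i j, (i, j) ∈ arcs n → (π i, π j) ∈ arcs n := by
    intro i j h
    simp only [arcs, mem_offDiag] at h ⊢
    exact ⟨hπ _ h.1, hπ _ h.2.1, fun h' => h.2.2 (π.injective h')⟩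
  exact ⟨fun a ha => hf.mem _ (key _ _ ha), fun i j => hf.symm _ _,
    fun i j j' h h' he => π.injective (hf.inj _ _ _ (key _ _ h) (key _ _ h') he)⟩

lemma IsCol.exists_eq {n : ℕ} {f : ℕ × ℕ → ℕ} (hf : IsCol n f) {i r : ℕ} (hi : i ∈ Icc 1 n)
    (hr : r ∈ Icc 1 (n - 1)) : ∃ j, (i, j) ∈ arcs n ∧ f (i, j) = r := by
  have hmem : ∀ j, j ∈ (Icc 1 n).erase i → (i, j) ∈ arcs n := by
    intro j hj
    rw [mem_erase] at hj
    exact mem_offDiag.2 ⟨hi, hj.2, hj.1.symm⟩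
  have := surjOn_of_injOn_of_card_le (s := (Icc 1 n).erase i) (t := Icc 1 (n - 1))
    (fun j => f (i, j)) (fun j hj => hf.mem _ (hmem j hj))
    (fun j hj j' hj' h => hf.inj _ _ _ (hmem j hj) (hmem j' hj') h)
    (by rw [card_erase_of_mem hi]; simp)
  obtain ⟨j, hj, h⟩ := this hr
  exact ⟨j, hmem j hj, h⟩

lemma swap_mem {s : Finset ℕ} {a b x : ℕ} (ha : a ∈ s) (hb : b ∈ s) (hx : x ∈ s) :
    Equiv.swap a b x ∈ s := by
  rw [Equiv.swap_apply_def]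
  split_ifs <;> assumption

lemma exists_isCol_of_disjoint {n : ℕ} (hn : 4 ≤ n) (he : Even n) {i j p q : ℕ}
    (hij : (i, j) ∈ arcs n) (hpq : (p, q) ∈ arcs n) (hip : i ≠ p) (hiq : i ≠ q) (hjp : j ≠ p)
    (hjq : j ≠ q) : ∃ f, IsCol n f ∧ f (i, j) = f (p, q) := by
  obtain ⟨f, hf⟩ := exists_isCol hn he
  have hpq' := mem_offDiag.1 hpq
  obtain ⟨q', hq', h⟩ := hf.exists_eq hpq'.1 (hf.mem _ hij)
  have hq'' := mem_offDiag.1 hq'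
  dsimp only at hpq' hq''
  have hji : (j, i) ∈ arcs n := by
    rw [mem_arcs] at hij ⊢; tauto
  have hiq' : i ≠ q' := by
    rintro rfl
    exact hjp (hf.inj i j p hij (by rw [mem_arcs] at hq' ⊢; tauto) (by rw [← h, hf.symm]))
  have hjq' : j ≠ q' := by
    rintro rfl
    exact hip (hf.inj j i p hji (by rw [mem_arcs] at hq' ⊢; tauto)
      (by rw [hf.symm i j, hf.symm p j, h]))
  refine ⟨_, hf.comp_perm (Equiv.swap q q') fun x hx => swap_mem hpq'.2.1 hq''.2.1 hx, ?_⟩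
  simp only [Equiv.swap_apply_left]
  rw [Equiv.swap_apply_of_ne_of_ne hiq hiq', Equiv.swap_apply_of_ne_of_ne hjq hjq',
    Equiv.swap_apply_of_ne_of_ne hpq'.2.2 hq''.2.2, h]

/-- Two colourings, one per orientation, make up a double round-robin schedule. -/
def doubleSched (n : ℕ) (f g : ℕ × ℕ → ℕ) (a : ℕ × ℕ) : ℕ :=
  if a.1 < a.2 then f a else g a + (n - 1)

lemma IsCol.eq_of_share {n : ℕ} {f : ℕ × ℕ → ℕ} (hf : IsCol n f) {a b : ℕ × ℕ} (ha : a ∈ arcs n)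
    (hb : b ∈ arcs n) (h : f a = f b)
    (hs : a.1 = b.1 ∨ a.1 = b.2 ∨ a.2 = b.1 ∨ a.2 = b.2) : a = b ∨ a = b.swap := by
  obtain ⟨i, j⟩ := a
  obtain ⟨i', j'⟩ := b
  have sw : ∀ x y, (x, y) ∈ arcs n → (y, x) ∈ arcs n := by
    intro x y; simp only [mem_arcs]; tauto
  simp only [Prod.swap_prod_mk, Prod.mk.injEq] at hs ⊢
  rcases hs with rfl | rfl | rfl | rfl
  · exact .inl ⟨rfl, hf.inj _ _ _ ha hb h⟩
  · exact .inr ⟨rfl, hf.inj _ _ _ ha (sw _ _ hb) (by rw [h, hf.symm])⟩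
  · exact .inr ⟨hf.inj _ _ _ (sw _ _ ha) hb (by rw [← h, hf.symm]), rfl⟩
  · exact .inl ⟨hf.inj _ _ _ (sw _ _ ha) (sw _ _ hb) (by rw [hf.symm, h, hf.symm]), rfl⟩

lemma isSched_doubleSched {n : ℕ} {f g : ℕ × ℕ → ℕ} (hf : IsCol n f) (hg : IsCol n g) :
    IsSched n (doubleSched n f g) := by
  constructor
  · intro a ha
    have h1 := mem_Icc.1 (hf.mem a ha)
    have h2 := mem_Icc.1 (hg.mem a ha)
    rw [mem_slots, doubleSched]
    split_ifs <;> omega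
  · intro a ha b hb h hs
    have ha1 := mem_Icc.1 (hf.mem a ha)
    have ha2 := mem_Icc.1 (hg.mem a ha)
    have hb1 := mem_Icc.1 (hf.mem b hb)
    have hb2 := mem_Icc.1 (hg.mem b hb)
    have hna := (mem_offDiag.1 ha).2.2
    have hnb := (mem_offDiag.1 hb).2.2
    unfold doubleSched at h
    split_ifs at h with h1 h2 h2
    · rcases hf.eq_of_share ha hb h hs with rfl | rfl
      · rfl
      · simp only [Prod.fst_swap, Prod.snd_swap] at h1; omega
    · omega
    · omega
    · rcases hg.eq_of_share ha hb (by omega) hs with rfl | rfl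
      · rfl
      · simp only [Prod.fst_swap, Prod.snd_swap] at h1; omega

lemma exists_isSched {n : ℕ} (hn : 4 ≤ n) (he : Even n) : ∃ s, IsSched n s := by
  obtain ⟨f, hf⟩ := exists_isCol hn he
  exact ⟨_, isSched_doubleSched hf hf⟩

lemma IsSched.perm_comp {n : ℕ} {s : ℕ × ℕ → ℕ} (hs : IsSched n s) (σ : Equiv.Perm ℕ)
    (hσ : ∀ k ∈ slots n, σ k ∈ slots n) : IsSched n (fun a => σ (s a)) :=
  ⟨fun a ha => hσ _ (hs.mem a ha), fun a ha b hb h => hs.inj a ha b hb (σ.injective h)⟩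

lemma exists_perm {s : Finset ℕ} {a b k l : ℕ} (ha : a ∈ s) (hb : b ∈ s) (hk : k ∈ s) (hl : l ∈ s)
    (hab : a ≠ b) (hkl : k ≠ l) :
    ∃ σ : Equiv.Perm ℕ, (∀ x ∈ s, σ x ∈ s) ∧ σ a = k ∧ σ b = l := by
  have hb' : Equiv.swap a k b ∈ s := swap_mem ha hk hb
  have hne : k ≠ Equiv.swap a k b := by
    intro h
    have : Equiv.swap a k a = Equiv.swap a k b := by rw [Equiv.swap_apply_left, ← h]
    exact hab ((Equiv.swap a k).injective this)
  refine ⟨(Equiv.swap a k).trans (Equiv.swap (Equiv.swap a k b) l), fun x hx => ?_, ?_, ?_⟩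
  · exact swap_mem hb' hl (swap_mem ha hk hx)
  · rw [Equiv.trans_apply, Equiv.swap_apply_left, Equiv.swap_apply_of_ne_of_ne hne hkl]
  · rw [Equiv.trans_apply, Equiv.swap_apply_left]

/-- Two pairs with a common team can be given any two prescribed distinct slots. -/
lemma exists_isSched_of_share {n : ℕ} (hn : 4 ≤ n) (he : Even n) {a b : ℕ × ℕ} {k l : ℕ}
    (ha : a ∈ arcs n) (hb : b ∈ arcs n) (hab : a ≠ b)
    (hs : a.1 = b.1 ∨ a.1 = b.2 ∨ a.2 = b.1 ∨ a.2 = b.2)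
    (hk : k ∈ slots n) (hl : l ∈ slots n) (hkl : k ≠ l) :
    ∃ s, IsSched n s ∧ s a = k ∧ s b = l := by
  obtain ⟨s, h⟩ := exists_isSched hn he
  obtain ⟨σ, h1, h2, h3⟩ := exists_perm (h.mem a ha) (h.mem b hb) hk hl
    (fun h' => hab (h.inj a ha b hb h' hs)) hkl
  exact ⟨_, h.perm_comp σ h1, h2, h3⟩

/-- Swapping the home venue of the two games between `i` and `j`. -/
lemma IsSched.swap_home {n : ℕ} {s : ℕ × ℕ → ℕ} (hs : IsSched n s) {i j : ℕ}
    (hij : (i, j) ∈ arcs n) : IsSched n (fun a => s (Equiv.swap (i, j) (j, i) a)) := by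
  have hji : (j, i) ∈ arcs n := by
    rw [mem_arcs] at hij ⊢; tauto
  have key : ∀ a ∈ arcs n, Equiv.swap (i, j) (j, i) a ∈ arcs n := by
    intro a ha
    rw [Equiv.swap_apply_def]
    split_ifs <;> assumption
  refine ⟨fun a ha => hs.mem _ (key a ha), fun a ha b hb h hab => ?_⟩
  refine (Equiv.swap (i, j) (j, i)).injective (hs.inj _ (key a ha) _ (key b hb) h ?_)
  obtain ⟨a1, a2⟩ := a
  obtain ⟨b1, b2⟩ := b
  simp only [Equiv.swap_apply_def, Prod.mk.injEq] at hab ⊢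
  split_ifs <;> simp only [true_or, or_true] <;> omega

section Functional

variable {n : ℕ} {C : ℕ → ℕ × ℕ → ℝ}

lemma swap_relation (hn : 4 ≤ n) (he : Even n)
    (H : ∀ s s', IsSched n s → IsSched n s' → ∑ a ∈ arcs n, C (s a) a = ∑ a ∈ arcs n, C (s' a) a)
    {k l : ℕ} (hk : k ∈ slots n) (hl : l ∈ slots n) {i j : ℕ} (hij : (i, j) ∈ arcs n) :
    C k (i, j) - C l (i, j) = C k (j, i) - C l (j, i) := by
  rcases eq_or_ne k l with rfl | hkl
  · simp
  have hji : (j, i) ∈ arcs n := by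
    rw [mem_arcs] at hij ⊢; tauto
  have hne : (i, j) ≠ (j, i) := by
    rw [mem_arcs] at hij; simp only [ne_eq, Prod.mk.injEq]; omega
  obtain ⟨s, hs, h1, h2⟩ := exists_isSched_of_share hn he hij hji hne (by simp) hk hl hkl
  have h := H _ _ hs (hs.swap_home hij)
  rw [← sub_eq_zero, ← sum_sub_distrib,
    ← sum_subset (s₁ := {(i, j), (j, i)}) (by simp [insert_subset_iff, hij, hji]),
    sum_pair hne] at h
  · simp only [Equiv.swap_apply_left, Equiv.swap_apply_right, h1, h2] at h
    linarith
  · intro a _ ha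
    simp only [mem_insert, mem_singleton, not_or] at ha
    rw [Equiv.swap_apply_of_ne_of_ne ha.1 ha.2, sub_self]

lemma sum_arcs_swap (F : ℕ × ℕ → ℝ) : ∑ a ∈ arcs n, F a.swap = ∑ a ∈ arcs n, F a := by
  refine sum_nbij' Prod.swap Prod.swap ?_ ?_ ?_ ?_ ?_ <;> simp [mem_arcs] <;> tauto

/-- A symmetric function has half its sum over the increasing pairs. -/
lemma two_mul_sum_lt {F : ℕ × ℕ → ℝ} (hF : ∀ a ∈ arcs n, F a.swap = F a) :
    2 * ∑ a ∈ arcs n, (if a.1 < a.2 then F a else 0) = ∑ a ∈ arcs n, F a ∧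
    2 * ∑ a ∈ arcs n, (if a.1 < a.2 then 0 else F a) = ∑ a ∈ arcs n, F a := by
  have h1 : ∑ a ∈ arcs n, (if a.1 < a.2 then F a else 0) =
      ∑ a ∈ arcs n, (if a.1 < a.2 then 0 else F a) := by
    rw [← sum_arcs_swap]
    refine sum_congr rfl fun a ha => ?_
    have := (mem_offDiag.1 ha).2.2
    rw [hF a ha]
    simp only [Prod.fst_swap, Prod.snd_swap]
    split_ifs <;> first | rfl | omega
  have h2 : ∑ a ∈ arcs n, (if a.1 < a.2 then F a else 0) +
      ∑ a ∈ arcs n, (if a.1 < a.2 then 0 else F a) = ∑ a ∈ arcs n, F a := by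
    rw [← sum_add_distrib]
    refine sum_congr rfl fun a _ => ?_
    split_ifs <;> simp
  constructor <;> linarith

lemma quad_relation (hn : 4 ≤ n) (he : Even n)
    (H : ∀ s s', IsSched n s → IsSched n s' → ∑ a ∈ arcs n, C (s a) a = ∑ a ∈ arcs n, C (s' a) a)
    {k l : ℕ} (hk : k ∈ slots n) (hl : l ∈ slots n) {i j p q : ℕ}
    (hij : (i, j) ∈ arcs n) (hpq : (p, q) ∈ arcs n) (hip : i ≠ p) (hiq : i ≠ q) (hjp : j ≠ p)
    (hjq : j ≠ q) :
    (C k (i, j) - C l (i, j)) + (C k (p, q) - C l (p, q)) =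
      (C k (p, j) - C l (p, j)) + (C k (i, q) - C l (i, q)) := by
  rcases eq_or_ne k l with rfl | hkl
  · simp
  obtain ⟨f, hf, hfr⟩ := exists_isCol_of_disjoint hn he hij hpq hip hiq hjp hjq
  have hi := (mem_offDiag.1 hij).1
  have hp := (mem_offDiag.1 hpq).1
  have hj := (mem_offDiag.1 hij).2.1
  have hq := (mem_offDiag.1 hpq).2.1
  have hijne := (mem_offDiag.1 hij).2.2
  have hpqne := (mem_offDiag.1 hpq).2.2
  dsimp only at hi hp hj hq hijne hpqne
  set π := Equiv.swap i p with hπ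
  have hg := hf.comp_perm π fun x hx => swap_mem hi hp hx
  set g : ℕ × ℕ → ℕ := fun a => f (π a.1, π a.2) with hgdef
  set r := f (i, j) with hr
  have hrm : r ∈ Icc 1 (n - 1) := hf.mem _ hij
  rw [mem_Icc] at hrm
  obtain ⟨σ, hσ, hσ1, hσ2⟩ := exists_perm (s := slots n) (a := r) (b := r + (n - 1))
    (by rw [mem_slots]; omega) (by rw [mem_slots]; omega) hk hl (by omega) hkl
  have hs := (isSched_doubleSched hf hg).perm_comp σ hσ
  have hs' := hs.perm_comp (Equiv.swap k l) fun x hx => swap_mem hk hl hx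
  have h := H _ _ hs hs'
  set D : ℕ × ℕ → ℝ := fun a => C k a - C l a with hD
  have hDs : ∀ a ∈ arcs n, D a.swap = D a := fun a ha => (swap_relation hn he H hk hl ha).symm
  have hterm : ∀ a ∈ arcs n, C (σ (doubleSched n f g a)) a -
      C (Equiv.swap k l (σ (doubleSched n f g a))) a =
      (if a.1 < a.2 then (if f a = r then D a else 0) else 0) -
      (if a.1 < a.2 then 0 else (if g a = r then D a else 0)) := by
    intro a ha
    have h1 := mem_Icc.1 (hf.mem a ha)
    have h2 := mem_Icc.1 (hg.mem a ha)
    have e1 : σ (doubleSched n f g a) = k ↔ doubleSched n f g a = r := by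
      rw [← hσ1, σ.injective.eq_iff]
    have e2 : σ (doubleSched n f g a) = l ↔ doubleSched n f g a = r + (n - 1) := by
      rw [← hσ2, σ.injective.eq_iff]
    rw [Equiv.swap_apply_def]
    by_cases c1 : σ (doubleSched n f g a) = k
    · have c1' := e1.1 c1
      rw [if_pos c1, c1]
      unfold doubleSched at c1'
      split_ifs at c1' ⊢
      · simp [hD]
      all_goals omega
    · rw [if_neg c1]
      rw [e1] at c1
      by_cases c2 : σ (doubleSched n f g a) = l
      · have c2' := e2.1 c2
        rw [if_pos c2, c2]
        unfold doubleSched at c2'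
        split_ifs at c2' ⊢
        · omega
        · omega
        · simp [hD]
        · omega
      · rw [if_neg c2]
        rw [e2] at c2
        unfold doubleSched at c1 c2
        split_ifs at c1 c2 ⊢ <;> first | omega | simp
  rw [← sub_eq_zero, ← sum_sub_distrib, sum_congr rfl hterm, sum_sub_distrib] at h
  have hF := (two_mul_sum_lt (n := n) (F := fun a => if f a = r then D a else 0)
    (fun a ha => by simp only [hDs a ha, show f a.swap = f a from hf.symm _ _])).1
  have hG := (two_mul_sum_lt (n := n) (F := fun a => if g a = r then D a else 0)
    (fun a ha => by simp only [hDs a ha, show g a.swap = g a from hg.symm _ _])).2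
  have hππ : ∀ x, π (π x) = x := fun x => Equiv.swap_apply_self i p x
  have hGF : ∑ a ∈ arcs n, (if g a = r then D a else 0) =
      ∑ a ∈ arcs n, (if f a = r then D (π a.1, π a.2) else 0) := by
    have hm : ∀ a ∈ arcs n, (π a.1, π a.2) ∈ arcs n := by
      intro a ha
      rw [arcs, mem_offDiag] at ha ⊢
      exact ⟨swap_mem hi hp ha.1, swap_mem hi hp ha.2.1, fun h' => ha.2.2 (π.injective h')⟩
    refine sum_nbij' (fun a => (π a.1, π a.2)) (fun a => (π a.1, π a.2)) hm hm ?_ ?_ ?_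
    · intro a _; simp [hππ]
    · intro a _; simp [hππ]
    · intro a _; simp [hππ, hgdef]
  have hkey : ∑ a ∈ arcs n, ((if f a = r then D a else 0) -
      (if f a = r then D (π a.1, π a.2) else 0)) = 0 := by
    rw [sum_sub_distrib]
    linarith
  have hji : (j, i) ∈ arcs n := by rw [mem_arcs] at hij ⊢; tauto
  have hqp : (q, p) ∈ arcs n := by rw [mem_arcs] at hpq ⊢; tauto
  have hpj : (p, j) ∈ arcs n := mem_offDiag.2 ⟨hp, hj, hjp.symm⟩
  have hiq' : (i, q) ∈ arcs n := mem_offDiag.2 ⟨hi, hq, hiq⟩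
  rw [← sum_subset (s₁ := {(i, j), (j, i), (p, q), (q, p)})
    (by simp [insert_subset_iff, hij, hji, hpq, hqp])] at hkey
  · rw [sum_insert (by simp; omega), sum_insert (by simp; omega), sum_insert (by simp; omega),
      sum_singleton] at hkey
    have f1 : f (j, i) = r := by rw [hf.symm]
    have f2 : f (q, p) = r := by rw [hf.symm, hfr]
    have p1 : π i = p := Equiv.swap_apply_left _ _
    have p2 : π p = i := Equiv.swap_apply_right _ _
    have p3 : π j = j := Equiv.swap_apply_of_ne_of_ne hijne.symm hjp
    have p4 : π q = q := Equiv.swap_apply_of_ne_of_ne hiq.symm hpqne.symm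
    simp only [f1, f2, ← hr, ← hfr, p1, p2, p3, p4, if_true] at hkey
    have d1 := hDs _ hij
    have d2 := hDs _ hpq
    have d3 := hDs _ hpj
    have d4 := hDs _ hiq'
    simp only [Prod.swap_prod_mk] at d1 d2 d3 d4
    change D (i, j) + D (p, q) = D (p, j) + D (i, q)
    linarith
  · intro a ha ha'
    split_ifs with hfa
    · simp only [mem_insert, mem_singleton, not_or] at ha'
      have a1 : ∀ x y, (x, y) ∈ arcs n → f (x, y) = r → ¬ (a = (x, y)) → ¬ (a = (y, x)) →
          a.1 ≠ x ∧ a.2 ≠ x := by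
        intro x y hxy hfx n1 n2
        constructor <;> intro hx
        · rcases hf.eq_of_share ha hxy (hfa.trans hfx.symm) (by simp [hx]) with h' | h'
          · exact n1 h'
          · exact n2 h'
        · rcases hf.eq_of_share ha hxy (hfa.trans hfx.symm) (by simp [hx]) with h' | h'
          · exact n1 h'
          · exact n2 h'
      have b1 := a1 i j hij rfl ha'.1 ha'.2.1
      have b2 := a1 p q hpq hfr.symm ha'.2.2.1 ha'.2.2.2
      rw [show π a.1 = a.1 from Equiv.swap_apply_of_ne_of_ne b1.1 b2.1,
        show π a.2 = a.2 from Equiv.swap_apply_of_ne_of_ne b1.2 b2.2, sub_self]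
    · simp

end Functional

/-- A symmetric function on pairs with the exchange property is a sum of vertex potentials. -/
lemma exists_potential {n : ℕ} (hn : 4 ≤ n) {E : ℕ → ℕ → ℝ}
    (hs : ∀ i j, (i, j) ∈ arcs n → E i j = E j i)
    (hq : ∀ i j p q, (i, j) ∈ arcs n → (p, q) ∈ arcs n → i ≠ p → i ≠ q → j ≠ p → j ≠ q →
      E i j + E p q = E p j + E i q) :
    ∃ α : ℕ → ℝ, ∀ i j, (i, j) ∈ arcs n → E i j = α i + α j := by
  have h1 : ∀ i u v v', (i, u) ∈ arcs n → (i, v) ∈ arcs n → (i, v') ∈ arcs n → u ≠ v → u ≠ v' →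
      E i u + E i v - E u v = E i u + E i v' - E u v' := by
    intro i u v v' hu hv hv' huv huv'
    rcases eq_or_ne v v' with rfl | hne
    · rfl
    rw [mem_arcs] at hu hv hv'
    have := hq i v u v' (by rw [mem_arcs]; omega) (by rw [mem_arcs]; omega) (by omega) (by omega)
      (by omega) (by omega)
    linarith
  have h2 : ∀ i u v u' v', (i, u) ∈ arcs n → (i, v) ∈ arcs n → (i, u') ∈ arcs n →
      (i, v') ∈ arcs n → u ≠ v → u' ≠ v' →
      E i u + E i v - E u v = E i u' + E i v' - E u' v' := by
    intro i u v u' v' hu hv hu' hv' huv huv'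
    have sy : ∀ x y, (i, x) ∈ arcs n → (i, y) ∈ arcs n → x ≠ y → E x y = E y x := by
      intro x y hx hy hxy
      rw [mem_arcs] at hx hy
      exact hs x y (by rw [mem_arcs]; omega)
    have s1 := sy u' v' hu' hv' huv'
    rcases eq_or_ne u v' with rfl | hne
    · have := h1 i u v u' hu hv hu' huv huv'.symm
      linarith
    · have a1 := h1 i u v v' hu hv hv' huv hne
      have a2 := h1 i v' u u' hv' hu hu' hne.symm huv'.symm
      have s2 := sy u v' hu hv' hne
      linarith
  have h3 : ∀ i, ∃ β : ℝ, ∀ u v, (i, u) ∈ arcs n → (i, v) ∈ arcs n → u ≠ v →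
      E i u + E i v - E u v = 2 * β := by
    intro i
    by_cases h : ∃ u v, (i, u) ∈ arcs n ∧ (i, v) ∈ arcs n ∧ u ≠ v
    · obtain ⟨u, v, hu, hv, huv⟩ := h
      refine ⟨(E i u + E i v - E u v) / 2, fun u' v' hu' hv' huv' => ?_⟩
      have := h2 i u v u' v' hu hv hu' hv' huv huv'
      linarith
    · exact ⟨0, fun u v hu hv huv => (h ⟨u, v, hu, hv, huv⟩).elim⟩
  choose α hα using h3
  refine ⟨α, fun i j hij => ?_⟩
  have hij' := mem_arcs.1 hij
  obtain ⟨u, hu1, hu2, hui, huj⟩ : ∃ u, 1 ≤ u ∧ u ≤ n ∧ u ≠ i ∧ u ≠ j := by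
    by_cases a1 : 1 ≠ i ∧ 1 ≠ j
    · exact ⟨1, by omega⟩
    by_cases a2 : 2 ≠ i ∧ 2 ≠ j
    · exact ⟨2, by omega⟩
    exact ⟨3, by omega⟩
  have e1 := hα i j u hij (by rw [mem_arcs]; omega) (by omega)
  have e2 := hα j i u (by rw [mem_arcs]; omega) (by rw [mem_arcs]; omega) (by omega)
  have e3 := hs i j hij
  have e4 := hs i u (by rw [mem_arcs]; omega)
  have e5 := hs j u (by rw [mem_arcs]; omega)
  linarith

/-- A functional that is constant on schedules vanishes on the solutions of the homogeneous
model equations. -/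
lemma sum_eq_zero_of_const {n : ℕ} (hn : 4 ≤ n) (he : Even n) {C W : ℕ → ℕ × ℕ → ℝ}
    (H : ∀ s s', IsSched n s → IsSched n s' → ∑ a ∈ arcs n, C (s a) a = ∑ a ∈ arcs n, C (s' a) a)
    (hW1 : ∀ k ∈ slots n, ∀ i ∈ Icc 1 n, ∑ j ∈ Icc 1 n \ {i}, (W k (i, j) + W k (j, i)) = 0)
    (hW2 : ∀ a ∈ arcs n, ∑ k ∈ slots n, W k a = 0) :
    ∑ k ∈ slots n, ∑ a ∈ arcs n, C k a * W k a = 0 := by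
  have h1 : 1 ∈ slots n := by rw [mem_slots]; omega
  have hbase : ∑ k ∈ slots n, ∑ a ∈ arcs n, C 1 a * W k a = 0 := by
    rw [sum_comm]
    refine sum_eq_zero fun a ha => ?_
    rw [← mul_sum, hW2 a ha, mul_zero]
  have hsub : ∑ k ∈ slots n, ∑ a ∈ arcs n, C k a * W k a = ∑ k ∈ slots n, ∑ a ∈ arcs n,
      C k a * W k a - ∑ k ∈ slots n, ∑ a ∈ arcs n, C 1 a * W k a := by
    rw [hbase, sub_zero]
  rw [hsub, ← sum_sub_distrib]
  refine sum_eq_zero fun k hk => ?_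
  rw [← sum_sub_distrib]
  obtain ⟨α, hα⟩ := exists_potential hn (E := fun i j => C k (i, j) - C 1 (i, j))
    (fun i j hij => swap_relation hn he H hk h1 hij)
    (fun i j p q hij hpq a b c d => quad_relation hn he H hk h1 hij hpq a b c d)
  have e1 : ∑ a ∈ arcs n, (C k a * W k a - C 1 a * W k a) =
      ∑ a ∈ arcs n, α a.1 * W k a + ∑ a ∈ arcs n, α a.2 * W k a := by
    rw [← sum_add_distrib]
    refine sum_congr rfl fun a ha => ?_
    have := hα a.1 a.2 ha
    simp only [Prod.mk.eta] at this
    rw [← sub_mul, this, add_mul]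
  have e2 : ∑ a ∈ arcs n, α a.2 * W k a = ∑ a ∈ arcs n, α a.1 * W k a.swap :=
    (sum_arcs_swap fun a => α a.2 * W k a).symm
  rw [e1, e2, ← sum_add_distrib]
  have e3 : ∑ a ∈ arcs n, (α a.1 * W k a + α a.1 * W k a.swap) =
      ∑ i ∈ Icc 1 n, ∑ j ∈ Icc 1 n \ {i}, α i * (W k (i, j) + W k (j, i)) := by
    rw [sum_sigma']
    refine sum_nbij' (fun a => ⟨a.1, a.2⟩) (fun x => (x.1, x.2)) ?_ ?_ ?_ ?_ ?_
    · rintro ⟨i, j⟩ h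
      rw [mem_arcs] at h
      simp only [mem_sigma, mem_sdiff, mem_Icc, mem_singleton]
      omega
    · rintro ⟨i, j⟩ h
      simp only [mem_sigma, mem_sdiff, mem_Icc, mem_singleton] at h
      exact mem_arcs.2 ⟨h.1, h.2.1, fun h' => h.2.2 h'.symm⟩
    · intro a _; rfl
    · intro a _; rfl
    · rintro ⟨i, j⟩ _
      simp only [Prod.swap_prod_mk]
      ring
  rw [e3]
  refine sum_eq_zero fun i hi => ?_
  rw [← mul_sum, hW1 k hk i hi, mul_zero]

/-- The set of matches of a schedule. -/
def schedSet (n : ℕ) (s : ℕ × ℕ → ℕ) : Set (ℕ × ℕ × ℕ) := {m | IsMatch n m ∧ s m.2 = m.1}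

lemma isMatch_iff {n : ℕ} {m : ℕ × ℕ × ℕ} : IsMatch n m ↔ m.1 ∈ slots n ∧ m.2 ∈ arcs n := by
  obtain ⟨k, i, j⟩ := m
  rw [mem_slots, mem_arcs, IsMatch]
  tauto

lemma IsSched.exists_arc {n : ℕ} {s : ℕ × ℕ → ℕ} (hs : IsSched n s) {t k : ℕ}
    (ht : t ∈ Icc 1 n) (hk : k ∈ slots n) : ∃ a ∈ arcs n, s a = k ∧ (t = a.1 ∨ t = a.2) := by
  set B := (Icc 1 n).erase t with hB
  have hm : ∀ j ∈ B, (t, j) ∈ arcs n ∧ (j, t) ∈ arcs n := by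
    intro j hj
    rw [hB, mem_erase] at hj
    exact ⟨mem_offDiag.2 ⟨ht, hj.2, hj.1.symm⟩, mem_offDiag.2 ⟨hj.2, ht, hj.1⟩⟩
  have hsurj := surjOn_of_injOn_of_card_le (s := B.disjSum B) (t := slots n)
    (Sum.elim (fun j => s (t, j)) (fun j => s (j, t))) ?_ ?_ ?_
  · obtain ⟨x, hx, hxk⟩ := hsurj hk
    rw [mem_coe, mem_disjSum] at hx
    rcases hx with ⟨j, hj, rfl⟩ | ⟨j, hj, rfl⟩
    · exact ⟨_, (hm j hj).1, hxk, .inl rfl⟩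
    · exact ⟨_, (hm j hj).2, hxk, .inr rfl⟩
  · intro x hx
    rw [mem_coe, mem_disjSum] at hx
    rcases hx with ⟨j, hj, rfl⟩ | ⟨j, hj, rfl⟩
    · exact hs.mem _ (hm j hj).1
    · exact hs.mem _ (hm j hj).2
  · intro x hx y hy hxy
    rw [mem_coe, mem_disjSum] at hx hy
    rcases hx with ⟨i, hi, rfl⟩ | ⟨i, hi, rfl⟩ <;> rcases hy with ⟨j, hj, rfl⟩ | ⟨j, hj, rfl⟩
    · have := hs.inj _ (hm i hi).1 _ (hm j hj).1 hxy (by simp)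
      simp_all
    · have := hs.inj _ (hm i hi).1 _ (hm j hj).2 hxy (by simp)
      simp_all
    · have := hs.inj _ (hm i hi).2 _ (hm j hj).1 hxy (by simp)
      simp_all
    · have := hs.inj _ (hm i hi).2 _ (hm j hj).2 hxy (by simp)
      simp_all
  · rw [card_disjSum, hB, card_erase_of_mem ht, slots]
    simp only [Nat.card_Icc]
    omega

lemma IsSched.isTournament {n : ℕ} {s : ℕ × ℕ → ℕ} (hs : IsSched n s) :
    IsTournament n (schedSet n s) := by
  refine ⟨fun m hm => hm.1, ?_, ?_⟩
  · intro k hk hk' t ht ht'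
    obtain ⟨a, ha, h1, h2⟩ := hs.exists_arc (mem_Icc.2 ⟨ht, ht'⟩) (mem_slots.2 ⟨hk, hk'⟩)
    refine ⟨(k, a), ⟨⟨isMatch_iff.2 ⟨mem_slots.2 ⟨hk, hk'⟩, ha⟩, h1⟩, rfl, h2⟩, ?_⟩
    rintro ⟨k', b⟩ ⟨⟨hb, hsb⟩, rfl, hb2⟩
    rw [Prod.mk.injEq]
    exact ⟨rfl, hs.inj _ (isMatch_iff.1 hb).2 _ ha (hsb.trans h1.symm) (by grind)⟩
  · intro i j hi hi' hj hj' hij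
    have ha : (i, j) ∈ arcs n := by rw [mem_arcs]; tauto
    exact ⟨s (i, j), ⟨isMatch_iff.2 ⟨hs.mem _ ha, ha⟩, rfl⟩, fun k hk => hk.2.symm⟩

lemma mem_of_venue_ne {T : Set (ℕ × ℕ × ℕ)} {t k v : ℕ} (h : venue T t k = v) (hv : v ≠ t) :
    (k, v, t) ∈ T := by
  unfold venue at h
  split_ifs at h with hex
  · obtain ⟨j, hj, hj'⟩ := hex.choose_spec
    rw [h] at hj hj'
    rcases hj' with h' | rfl
    · exact (hv h'.symm).elim
    · exact hj
  · exact (hv h.symm).elim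

lemma venue_eq {n : ℕ} {s : ℕ × ℕ → ℕ} (hs : IsSched n s) {t v : ℕ} (h : (v, t) ∈ arcs n) :
    venue (schedSet n s) t (s (v, t)) = v := by
  have hex : ∃ i, ∃ j, (s (v, t), i, j) ∈ schedSet n s ∧ (t = i ∨ t = j) :=
    ⟨v, t, ⟨isMatch_iff.2 ⟨hs.mem _ h, h⟩, rfl⟩, .inr rfl⟩
  unfold venue
  rw [dif_pos hex]
  obtain ⟨j, ⟨hm, he⟩, hj'⟩ := hex.choose_spec
  have := hs.inj _ (isMatch_iff.1 hm).2 _ h he (by dsimp only; grind)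
  exact (Prod.ext_iff.1 this).1

/-- Every single travel can be avoided by some schedule. -/
lemma exists_travel_eq_zero {n : ℕ} (hn : 4 ≤ n) (he : Even n) {p : ℕ × ℕ × ℕ}
    (hp : IsTravelIdx n p) : ∃ s, IsSched n s ∧ travel n (schedSet n s) p = 0 := by
  obtain ⟨t, i, j⟩ := p
  obtain ⟨ht, ht', hi, hi', hj, hj', hij⟩ := hp
  dsimp only at ht ht' hi hi' hj hj' hij
  obtain ⟨x, hx, hx', hxt, hxi, hxj⟩ : ∃ x, 1 ≤ x ∧ x ≤ n ∧ x ≠ t ∧ x ≠ i ∧ x ≠ j := by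
    by_cases a1 : 1 ≠ t ∧ 1 ≠ i ∧ 1 ≠ j
    · exact ⟨1, by omega⟩
    by_cases a2 : 2 ≠ t ∧ 2 ≠ i ∧ 2 ≠ j
    · exact ⟨2, by omega⟩
    by_cases a3 : 3 ≠ t ∧ 3 ≠ i ∧ 3 ≠ j
    · exact ⟨3, by omega⟩
    exact ⟨4, by omega⟩
  have hxt' : (x, t) ∈ arcs n := by rw [mem_arcs]; omega
  have h1 : 1 ∈ slots n := by rw [mem_slots]; omega
  have h2 : 2 ∈ slots n := by rw [mem_slots]; omega
  rcases eq_or_ne i t with rfl | hit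
  · have hjt : (j, i) ∈ arcs n := by rw [mem_arcs]; omega
    obtain ⟨s, hs, e1, e2⟩ := exists_isSched_of_share hn he hxt' hjt
      (by simpa using hxj) (by simp) h1 h2 (by norm_num)
    refine ⟨s, hs, if_neg ?_⟩
    rintro ⟨k, -, hk1, hk2⟩
    have hm := (mem_of_venue_ne hk2 hij.symm).2
    dsimp only at hm hk1
    obtain rfl : k = 1 := by omega
    have := venue_eq hs hxt'
    rw [e1, hk1] at this
    exact hxi this.symm
  · have hitm : (i, t) ∈ arcs n := by rw [mem_arcs]; omega
    obtain ⟨s, hs, e1, e2⟩ := exists_isSched_of_share hn he hitm hxt'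
      (by simpa using hxi.symm) (by simp) h1 h2 (by norm_num)
    refine ⟨s, hs, if_neg ?_⟩
    rintro ⟨k, -, hk1, hk2⟩
    have hm := (mem_of_venue_ne hk1 hit).2
    dsimp only at hm hk2
    obtain rfl : k = 1 := by omega
    have := venue_eq hs hxt'
    rw [e2, hk2] at this
    exact hxj this.symm

/-- The vertices of the polytope. -/
def IsVertex (n : ℕ) (z : Pt n) : Prop :=
  ∃ T : Set (ℕ × ℕ × ℕ), IsTournament n T ∧
    (∀ m : {m : ℕ × ℕ × ℕ // IsMatch n m}, z.1 m = play T m.1) ∧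
    (∀ p : {p : ℕ × ℕ × ℕ // IsTravelIdx n p}, z.2 p = 0 ∨ z.2 p = 1) ∧
    (∀ p : {p : ℕ × ℕ × ℕ // IsTravelIdx n p}, travel n T p.1 ≤ z.2 p)

/-- The model equations. -/
def ModelEq (n : ℕ) (z : Pt n) : Prop :=
  (∀ k, 1 ≤ k → k ≤ 2 * n - 2 → ∀ i, 1 ≤ i → i ≤ n →
    ∑ j ∈ Icc 1 n \ {i}, (xval z k i j + xval z k j i) = 1) ∧
  (∀ i j, 1 ≤ i → i ≤ n → 1 ≤ j → j ≤ n → i ≠ j →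
    ∑ k ∈ Icc 1 (2 * n - 2), xval z k i j = 1)

lemma xval_add {n : ℕ} (z w : Pt n) (k i j : ℕ) :
    xval (z + w) k i j = xval z k i j + xval w k i j := by
  unfold xval; split_ifs <;> simp

lemma xval_sub {n : ℕ} (z w : Pt n) (k i j : ℕ) :
    xval (z - w) k i j = xval z k i j - xval w k i j := by
  unfold xval; split_ifs <;> simp

lemma xval_smul {n : ℕ} (c : ℝ) (z : Pt n) (k i j : ℕ) :
    xval (c • z) k i j = c * xval z k i j := by
  unfold xval; split_ifs <;> simp

lemma IsVertex.modelEq {n : ℕ} {z : Pt n} (hz : IsVertex n z) : ModelEq n z := by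
  obtain ⟨T, hT, hx, -, -⟩ := hz
  have hxv : ∀ k i j, xval z k i j = if (k, i, j) ∈ T then 1 else 0 := by
    intro k i j
    unfold xval
    split_ifs with h h' h'
    · rw [hx]; exact if_pos h'
    · rw [hx]; exact if_neg h'
    · exact (h (hT.subset _ h')).elim
    · rfl
  simp only [ModelEq, hxv]
  constructor
  · intro k hk hk' i hi hi'
    obtain ⟨⟨k', a, b⟩, ⟨hm, rfl, hi2⟩, huniq⟩ := hT.slot_team k hk hk' i hi hi'
    have hM := hT.subset _ hm
    obtain ⟨-, -, ha, ha', hb, hb', hab⟩ := hM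
    dsimp only at *
    rcases hi2 with rfl | rfl
    · rw [sum_eq_single b]
      · have : (k', b, i) ∉ T := by
          intro h
          have := huniq _ ⟨h, rfl, .inr rfl⟩
          simp only [Prod.mk.injEq] at this
          omega
        rw [if_pos hm, if_neg this, add_zero]
      · intro j _ hjb
        rw [if_neg, if_neg, add_zero]
        · intro h
          have := huniq _ ⟨h, rfl, .inr rfl⟩
          simp only [Prod.mk.injEq] at this
          omega
        · intro h
          have := huniq _ ⟨h, rfl, .inl rfl⟩
          simp only [Prod.mk.injEq] at this
          omega
      · intro h
        simp only [mem_sdiff, mem_Icc, mem_singleton] at h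
        omega
    · rw [sum_eq_single a]
      · have : (k', i, a) ∉ T := by
          intro h
          have := huniq _ ⟨h, rfl, .inl rfl⟩
          simp only [Prod.mk.injEq] at this
          omega
        rw [if_pos hm, if_neg this, zero_add]
      · intro j _ hjb
        rw [if_neg, if_neg, add_zero]
        · intro h
          have := huniq _ ⟨h, rfl, .inr rfl⟩
          simp only [Prod.mk.injEq] at this
          omega
        · intro h
          have := huniq _ ⟨h, rfl, .inl rfl⟩
          simp only [Prod.mk.injEq] at this
          omega
      · intro h
        simp only [mem_sdiff, mem_Icc, mem_singleton] at h
        omega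
  · intro i j hi hi' hj hj' hij
    obtain ⟨k, hk, huniq⟩ := hT.pair i j hi hi' hj hj' hij
    rw [sum_eq_single k, if_pos hk]
    · intro k' _ hne
      exact if_neg fun h => hne (huniq _ h)
    · intro h
      have := hT.subset _ hk
      exact (h (mem_Icc.2 ⟨this.1, this.2.1⟩)).elim

lemma modelEq_of_mem_affineSpan {n : ℕ} {z : Pt n}
    (hz : z ∈ affineSpan ℝ {z : Pt n | IsVertex n z}) : ModelEq n z := by
  refine affineSpan_induction hz (fun x hx => IsVertex.modelEq hx) ?_
  · intro c u v w hu hv hw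
    simp only [ModelEq, vsub_eq_sub, vadd_eq_add, xval_add, xval_smul, xval_sub] at *
    constructor
    · intro k hk hk' i hi hi'
      have a1 := hu.1 k hk hk' i hi hi'
      have a2 := hv.1 k hk hk' i hi hi'
      have a3 := hw.1 k hk hk' i hi hi'
      simp only [sum_add_distrib, sum_sub_distrib, ← mul_sum] at *
      linear_combination c * a1 - c * a2 + a3
    · intro i j hi hi' hj hj' hij
      have a1 := hu.2 i j hi hi' hj hj' hij
      have a2 := hv.2 i j hi hi' hj hj' hij
      have a3 := hw.2 i j hi hi' hj hj' hij
      simp only [sum_add_distrib, sum_sub_distrib, ← mul_sum] at *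
      linear_combination c * a1 - c * a2 + a3

/-- The point given by a schedule and a travel vector. -/
noncomputable def schedPt (n : ℕ) (s : ℕ × ℕ → ℕ)
    (y : {p : ℕ × ℕ × ℕ // IsTravelIdx n p} → ℝ) : Pt n :=
  (fun m => play (schedSet n s) m.1, y)

lemma travel_le_one (n : ℕ) (T : Set (ℕ × ℕ × ℕ)) (p : ℕ × ℕ × ℕ) : travel n T p ≤ 1 := by
  unfold travel; split_ifs <;> norm_num

lemma IsSched.isVertex_one {n : ℕ} {s : ℕ × ℕ → ℕ} (hs : IsSched n s) :
    IsVertex n (schedPt n s 1) :=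
  ⟨_, hs.isTournament, fun _ => rfl, fun _ => .inr rfl, fun _ => travel_le_one _ _ _⟩

lemma IsSched.isVertex_one_sub_single {n : ℕ} {s : ℕ × ℕ → ℕ} (hs : IsSched n s)
    {p : {p : ℕ × ℕ × ℕ // IsTravelIdx n p}} (hp : travel n (schedSet n s) p.1 = 0) :
    IsVertex n (schedPt n s (1 - Pi.single p 1)) := by
  refine ⟨_, hs.isTournament, fun _ => rfl, fun q => ?_, fun q => ?_⟩
  · rcases eq_or_ne q p with rfl | h
    · left; simp [schedPt]
    · right; simp [schedPt, h]
  · rcases eq_or_ne q p with rfl | h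
    · simp [schedPt, hp]
    · simpa [schedPt, h] using travel_le_one _ _ _

instance finite_match (n : ℕ) : Finite {m : ℕ × ℕ × ℕ // IsMatch n m} :=
  Set.Finite.subset ((slots n) ×ˢ (arcs n)).finite_toSet
    fun _ hm => mem_coe.2 (mem_product.2 (isMatch_iff.1 hm))

instance finite_travelIdx (n : ℕ) : Finite {p : ℕ × ℕ × ℕ // IsTravelIdx n p} :=
  Set.Finite.subset ((Icc 1 n) ×ˢ (Icc 1 n) ×ˢ (Icc 1 n)).finite_toSet
    fun p hp => by
      obtain ⟨h1, h2, h3, h4, h5, h6, -⟩ := hp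
      exact mem_coe.2 (mem_product.2 ⟨mem_Icc.2 ⟨h1, h2⟩,
        mem_product.2 ⟨mem_Icc.2 ⟨h3, h4⟩, mem_Icc.2 ⟨h5, h6⟩⟩⟩)

/-- The coefficient of a linear functional at a play coordinate. -/
noncomputable def coeff {n : ℕ} (f : Pt n →ₗ[ℝ] ℝ) (k : ℕ) (a : ℕ × ℕ) : ℝ :=
  if h : IsMatch n (k, a) then f (Pi.single ⟨(k, a), h⟩ 1, 0) else 0

lemma apply_fst {n : ℕ} (f : Pt n →ₗ[ℝ] ℝ) (z : Pt n) :
    f (z.1, 0) = ∑ k ∈ slots n, ∑ a ∈ arcs n, coeff f k a * xval z k a.1 a.2 := by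
  have := Fintype.ofFinite {m : ℕ × ℕ × ℕ // IsMatch n m}
  have h1 := LinearMap.pi_apply_eq_sum_univ (f.comp (LinearMap.inl ℝ _ _)) z.1
  simp only [LinearMap.comp_apply, LinearMap.inl_apply] at h1
  rw [h1, ← sum_product', sum_subtype (p := IsMatch n) _
    (fun m => by rw [mem_product, isMatch_iff])]
  refine sum_congr rfl fun m _ => ?_
  have hc : coeff f m.1.1 m.1.2 = f (Pi.single m 1, 0) := dif_pos m.2
  have hx : xval z m.1.1 m.1.2.1 m.1.2.2 = z.1 m := dif_pos m.2
  rw [hc, hx, smul_eq_mul, mul_comm]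
  congr 3
  ext q
  simp [Pi.single_apply, eq_comm]

lemma apply_schedPt {n : ℕ} (f : Pt n →ₗ[ℝ] ℝ) {s : ℕ × ℕ → ℕ} (hs : IsSched n s)
    (y : {p : ℕ × ℕ × ℕ // IsTravelIdx n p} → ℝ) :
    f (schedPt n s y) = ∑ a ∈ arcs n, coeff f (s a) a + f (0, y) := by
  have h : schedPt n s y = ((schedPt n s y).1, 0) + (0, y) := by simp [schedPt]
  rw [h, map_add, apply_fst, sum_comm]
  congr 1
  refine sum_congr rfl fun a ha => ?_
  have hx : ∀ k ∈ slots n, xval (schedPt n s y) k a.1 a.2 = if s a = k then 1 else 0 := by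
    intro k hk
    have hm : IsMatch n (k, a.1, a.2) := isMatch_iff.2 ⟨hk, ha⟩
    unfold xval
    rw [dif_pos hm]
    simp [schedPt, play, schedSet, hm]
  rw [sum_congr rfl fun k hk => by rw [hx k hk]]
  simp [hs.mem a ha]

lemma mem_affineSpan_of_modelEq {n : ℕ} (hn : 4 ≤ n) (he : Even n) {z : Pt n}
    (hz : ModelEq n z) : z ∈ affineSpan ℝ {z : Pt n | IsVertex n z} := by
  obtain ⟨s₀, hs₀⟩ := exists_isSched hn he
  set z₀ := schedPt n s₀ 1 with hz₀
  have hv₀ : IsVertex n z₀ := hs₀.isVertex_one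
  have hsub : ∀ {u}, IsVertex n u → u ∈ affineSpan ℝ {z : Pt n | IsVertex n z} :=
    fun hu => subset_affineSpan ℝ _ hu
  rw [← AffineSubspace.vsub_right_mem_direction_iff_mem (hsub hv₀)]
  by_contra hcon
  obtain ⟨f, hf, hker⟩ := Submodule.exists_le_ker_of_notMem hcon
  apply hf
  have hconst : ∀ u v, IsVertex n u → IsVertex n v → f u = f v := by
    intro u v hu hv
    have := hker (AffineSubspace.vsub_mem_direction (hsub hu) (hsub hv))
    rwa [LinearMap.mem_ker, vsub_eq_sub, map_sub, sub_eq_zero] at this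
  have hy : ∀ y, f (0, y) = 0 := by
    intro y
    have := Fintype.ofFinite {p : ℕ × ℕ × ℕ // IsTravelIdx n p}
    have h1 := LinearMap.pi_apply_eq_sum_univ (f.comp (LinearMap.inr ℝ _ _)) y
    simp only [LinearMap.comp_apply, LinearMap.inr_apply] at h1
    rw [h1]
    refine sum_eq_zero fun p _ => ?_
    obtain ⟨s, hs, hp⟩ := exists_travel_eq_zero hn he p.2
    have h2 := hconst _ _ hs.isVertex_one (hs.isVertex_one_sub_single hp)
    rw [apply_schedPt f hs, apply_schedPt f hs, add_right_inj, ← sub_eq_zero, ← map_sub] at h2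
    have h3 : ((0, 1) : Pt n) - (0, 1 - Pi.single p 1) = (0, fun q => if p = q then 1 else 0) := by
      ext q
      · simp
      · simp [Pi.single_apply, eq_comm]
    rw [h3] at h2
    rw [h2, smul_zero]
  have hw : z -ᵥ z₀ = ((z - z₀).1, 0) + (0, (z - z₀).2) := by simp [Prod.ext_iff]
  rw [hw, map_add, hy, add_zero, apply_fst]
  have hm₀ := hv₀.modelEq
  refine sum_eq_zero_of_const hn he (W := fun k a => xval (z - z₀) k a.1 a.2) ?_ ?_ ?_
  · intro s s' hs hs'
    have h := hconst _ _ hs.isVertex_one hs'.isVertex_one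
    rwa [apply_schedPt f hs, apply_schedPt f hs', add_left_inj] at h
  · intro k hk i hi
    rw [mem_slots] at hk
    rw [mem_Icc] at hi
    have a1 := hz.1 k hk.1 hk.2 i hi.1 hi.2
    have a2 := hm₀.1 k hk.1 hk.2 i hi.1 hi.2
    simp only [xval_sub, sum_add_distrib, sum_sub_distrib] at *
    linarith
  · rintro ⟨i, j⟩ ha
    rw [mem_arcs] at ha
    have a1 := hz.2 i j ha.1.1 ha.1.2 ha.2.1.1 ha.2.1.2 ha.2.2
    have a2 := hm₀.2 i j ha.1.1 ha.1.2 ha.2.1.1 ha.2.1.2 ha.2.2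
    simp only [xval_sub, sum_sub_distrib, slots] at *
    linarith

/-- the affine hull of `Ptt(n)` is described exactly by the model
equations. -/
theorem affine_hull_Ptt (n : ℕ) (hn : 4 ≤ n) (heven : Even n) :
    (affineSpan ℝ (Ptt n) : Set (Pt n)) =
      { z : Pt n |
        (∀ k, 1 ≤ k → k ≤ 2 * n - 2 → ∀ i, 1 ≤ i → i ≤ n →
          ∑ j ∈ Finset.Icc 1 n \ {i}, (xval z k i j + xval z k j i) = 1) ∧
        (∀ i j, 1 ≤ i → i ≤ n → 1 ≤ j → j ≤ n → i ≠ j →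
          ∑ k ∈ Finset.Icc 1 (2 * n - 2), xval z k i j = 1) } := by
  ext z
  have hspan : affineSpan ℝ (Ptt n) = affineSpan ℝ {z : Pt n | IsVertex n z} :=
    affineSpan_convexHull _
  rw [hspan]
  exact ⟨modelEq_of_mem_affineSpan, mem_affineSpan_of_modelEq hn heven⟩

end TTP
end
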